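/- arXiv:2008.10315 — 3 statements merged into one kernel-verified Lean document; each statement's English description precedes it below -/
import Mathlib

section
/- Let U ⊆ A_2 be a base-point-free linear subspace of codimension 2 (n ≥ 2). Then the Hilbert function of the ideal ⟨U⟩ is (1, n, 2, 0, 0, …): dim (A/⟨U⟩)_0 = 1, dim (A/⟨U⟩)_1 = n, dim (A/⟨U⟩)_2 = 2, and dim (A/⟨U⟩)_t = 0 for all t ≥ 3. -/
open MvPolynomial Module

noncomputable section

abbrev PolyR (n : ℕ) := MvPolynomial (Fin n) ℂ

def formSpace (n d : ℕ) : Submodule ℂ (PolyR n) :=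
  homogeneousSubmodule (Fin n) ℂ d

/-- Codimension of a subspace `U` inside the space of degree-`d` forms. -/
def vcodim (n d : ℕ) (U : Submodule ℂ (PolyR n)) : ℕ :=
  finrank ℂ (formSpace n d) - finrank ℂ U

/-- `U` is base-point-free: the only common zero of its members in `ℂⁿ` is `0`. -/
def IsBPF (n : ℕ) (U : Submodule ℂ (PolyR n)) : Prop :=
  ∀ x : Fin n → ℂ, (∀ p ∈ U, eval x p = 0) → x = 0

/-- `m(n,d,k)`: maximum of `codim U²` over codimension-`k` subspaces `U ⊆ A(n)_d`. -/
def mMax (n d k : ℕ) : ℕ :=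
  sSup { s | ∃ U : Submodule ℂ (PolyR n),
    U ≤ formSpace n d ∧ vcodim n d U = k ∧ vcodim n (2 * d) (U * U) = s }

def linForm (n : ℕ) (c : Fin n → ℂ) : PolyR n := ∑ i, c i • X i

def colon (n d : ℕ) (U : Submodule ℂ (PolyR n)) (l : PolyR n) : Submodule ℂ (PolyR n) :=
  Submodule.comap (LinearMap.mulLeft ℂ l) U ⊓ formSpace n (d - 1)

end

/-- The degree-`i` component of a homogeneous ideal, as a `ℂ`-subspace. -/
noncomputable def idealComp (n : ℕ) (I : Ideal (PolyR n)) (i : ℕ) :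
    Submodule ℂ (PolyR n) :=
  Submodule.restrictScalars ℂ I ⊓ formSpace n i

/-- The Hilbert function `h_I(i) = dim (A/I)_i`. -/
noncomputable def hilb (n : ℕ) (I : Ideal (PolyR n)) (i : ℕ) : ℕ :=
  finrank ℂ (formSpace n i) - finrank ℂ (idealComp n I i)

namespace Stmt15

lemma exists_two {V W : Type*} [AddCommGroup V] [Module ℂ V] [AddCommGroup W] [Module ℂ W]
    [FiniteDimensional ℂ V] (f : V →ₗ[ℂ] W) (h : finrank ℂ (LinearMap.range f) ≤ 2) :
    ∃ e1 e2 : V, ∀ v, ∃ s t : ℂ, f v = s • f e1 + t • f e2 := by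
  obtain ⟨r, hr⟩ : ∃ r, finrank ℂ (LinearMap.range f) = r := ⟨_, rfl⟩
  rw [hr] at h
  let b := Module.finBasisOfFinrankEq ℂ (LinearMap.range f) hr
  have key : ∀ v, f v = ∑ i, b.repr ⟨f v, v, rfl⟩ i • (b i : W) := by
    intro v
    have := congrArg Subtype.val (b.sum_repr ⟨f v, v, rfl⟩)
    rw [AddSubmonoidClass.coe_finsetSum] at this
    exact this.symm
  have hb : ∀ i, ∃ e, f e = b i := fun i => (b i).2
  choose e he using hb
  clear_value b
  interval_cases r
  · refine ⟨0, 0, fun v => ⟨0, 0, ?_⟩⟩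
    rw [key v]; simp
  · refine ⟨e 0, 0, fun v => ⟨b.repr ⟨f v, v, rfl⟩ 0, 0, ?_⟩⟩
    rw [he]
    conv_lhs => rw [key v]
    simp
  · refine ⟨e 0, e 1, fun v => ⟨b.repr ⟨f v, v, rfl⟩ 0, b.repr ⟨f v, v, rfl⟩ 1, ?_⟩⟩
    rw [he, he]
    conv_lhs => rw [key v]
    simp [Fin.sum_univ_two]

/-- A binary quadratic form over `ℂ` has a nontrivial zero. -/
lemma exists_root (A B C : ℂ) : ∃ s t : ℂ, (s ≠ 0 ∨ t ≠ 0) ∧ A * s ^ 2 + B * s * t + C * t ^ 2 = 0 := by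
  by_cases hA : A = 0
  · exact ⟨1, 0, by simp, by simp [hA]⟩
  · obtain ⟨d, hd⟩ := IsAlgClosed.exists_pow_nat_eq (B ^ 2 - 4 * A * C) (n := 2) (by norm_num)
    refine ⟨-B + d, 2 * A, Or.inr (by simpa using hA), ?_⟩
    linear_combination A * hd

lemma exists_sqrt (p q r : ℂ) (h : p * r = q ^ 2) :
    ∃ u v : ℂ, u * u = p ∧ u * v = q ∧ v * v = r := by
  obtain ⟨u, hu⟩ := IsAlgClosed.exists_pow_nat_eq p (n := 2) (by norm_num)
  by_cases h0 : u = 0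
  · subst h0
    obtain ⟨v, hv⟩ := IsAlgClosed.exists_pow_nat_eq r (n := 2) (by norm_num)
    have hp : p = 0 := by simpa using hu.symm
    subst hp
    have hq : q = 0 := by simpa using h.symm
    exact ⟨0, v, by simp, by simp [hq], by rw [← hv]; ring⟩
  · refine ⟨u, q / u, by rw [← hu]; ring, by field_simp, ?_⟩
    field_simp
    rw [← h, ← hu]

lemma span_one (n : ℕ) : formSpace n 1 = Submodule.span ℂ (Set.range (X : Fin n → PolyR n)) :=
  homogeneousSubmodule_one_eq_span_X

lemma formSpace_mul (n a b : ℕ) : formSpace n a * formSpace n b = formSpace n (a + b) := by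
  unfold formSpace
  rw [← homogeneousSubmodule_one_pow _ a, ← homogeneousSubmodule_one_pow _ b, ← pow_add,
    homogeneousSubmodule_one_pow]

instance (n d : ℕ) : FiniteDimensional ℂ (formSpace n d) :=
  Module.Finite.iff_fg.mpr (homogeneousSubmodule_fg _ _ d)

lemma finrank_one (n : ℕ) : finrank ℂ (formSpace n 1) = n := by
  rw [span_one, finrank_span_eq_card (linearIndependent_X (Fin n) ℂ)]
  simp

lemma finrank_zero (n : ℕ) : finrank ℂ (formSpace n 0) = 1 := by
  have : formSpace n 0 = Submodule.span ℂ {(1 : PolyR n)} := by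
    unfold formSpace
    rw [homogeneousSubmodule_zero, Submodule.one_eq_span]
  rw [this, finrank_span_singleton one_ne_zero]

/-- Components of elements of the ideal in degrees at most two. -/
lemma comp_mem (n : ℕ) (U : Submodule ℂ (PolyR n)) (hU : U ≤ formSpace n 2) (p : PolyR n)
    (hp : p ∈ Ideal.span (U : Set (PolyR n))) :
    homogeneousComponent 0 p = 0 ∧ homogeneousComponent 1 p = 0 ∧ homogeneousComponent 2 p ∈ U := by
  have key : ∀ (f u : PolyR n), u ∈ U → ∀ k, homogeneousComponent k (f * u) =
      ∑ i ∈ Finset.range (f.totalDegree + 1), if k = i + 2 then homogeneousComponent i f * u else 0 := by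
    intro f u hu k
    conv_lhs => rw [← sum_homogeneousComponent f, Finset.sum_mul, map_sum]
    refine Finset.sum_congr rfl fun i _ => ?_
    have : homogeneousComponent i f * u ∈ homogeneousSubmodule (Fin n) ℂ (i + 2) :=
      (homogeneousComponent_isHomogeneous i f).mul (hU hu)
    rw [homogeneousComponent_of_mem this]
  have main : ∀ f : PolyR n, homogeneousComponent 0 (f * p) = 0 ∧
      homogeneousComponent 1 (f * p) = 0 ∧ homogeneousComponent 2 (f * p) ∈ U := by
    induction hp using Submodule.span_induction with
    | mem x hx =>
      intro f
      refine ⟨?_, ?_, ?_⟩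
      · rw [key f x hx]; exact Finset.sum_eq_zero fun i _ => if_neg (by omega)
      · rw [key f x hx]; exact Finset.sum_eq_zero fun i _ => if_neg (by omega)
      · rw [key f x hx]
        refine U.sum_mem fun i _ => ?_
        split_ifs with h
        · obtain rfl : i = 0 := by omega
          rw [homogeneousComponent_zero, ← smul_eq_C_mul]
          exact U.smul_mem _ hx
        · exact U.zero_mem
    | zero => simp
    | add x y _ _ hx hy =>
      intro f
      rw [mul_add]
      refine ⟨?_, ?_, ?_⟩
      · rw [map_add, (hx f).1, (hy f).1, add_zero]
      · rw [map_add, (hx f).2.1, (hy f).2.1, add_zero]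
      · rw [map_add]; exact U.add_mem (hx f).2.2 (hy f).2.2
    | smul a x _ hx =>
      intro f
      have := hx (f * a)
      rwa [mul_assoc] at this
  simpa using main 1

/-- If the pencil element `a` has rank at most one then it vanishes. -/
lemma rank_one (n : ℕ) (U : Submodule ℂ (PolyR n)) (hU : U ≤ formSpace n 2) (hbpf : IsBPF n U)
    (φ : PolyR n →ₗ[ℂ] ℂ) (hφ : ∀ l ∈ formSpace n 1, ∀ u ∈ U, φ (l * u) = 0)
    (e1 e2 : PolyR n) (h1 : e1 ∈ formSpace n 1) (h2 : e2 ∈ formSpace n 1)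
    (hspan : ∀ v ∈ formSpace n 1, ∃ s t : ℂ, ∀ q ∈ formSpace n 2,
      φ (v * q) = s * φ (e1 * q) + t * φ (e2 * q))
    (a : PolyR n) (ha : a ∈ formSpace n 1)
    (hdet : φ (a * (e1 * e1)) * φ (a * (e2 * e2)) = φ (a * (e1 * e2)) ^ 2) :
    ∀ q ∈ formSpace n 2, φ (a * q) = 0 := by
  obtain ⟨u, v, hu, huv, hv⟩ := exists_sqrt _ _ _ hdet
  have hX : ∀ i : Fin n, (X i : PolyR n) ∈ formSpace n 1 := fun i => isHomogeneous_X ℂ i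
  have hm : ∀ x ∈ formSpace n 1, ∀ y ∈ formSpace n 1, x * y ∈ formSpace n 2 :=
    fun x hx y hy => IsHomogeneous.mul hx hy
  choose s t hst using fun i => hspan (X i) (hX i)
  let x : Fin n → ℂ := fun i => s i * u + t i * v
  have hxx : ∀ i j, φ (a * (X i * X j)) = x i * x j := by
    intro i j
    have a1 : φ (a * (X i * X j)) = s i * φ (e1 * (a * X j)) + t i * φ (e2 * (a * X j)) := by
      rw [← hst i _ (hm _ ha _ (hX j))]; congr 1; ring
    have a2 : φ (e1 * (a * X j)) = s j * φ (a * (e1 * e1)) + t j * φ (a * (e1 * e2)) := by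
      have := hst j _ (hm _ h1 _ ha)
      rw [show e1 * (a * X j) = X j * (e1 * a) by ring, this]
      congr 3 <;> ring
    have a3 : φ (e2 * (a * X j)) = s j * φ (a * (e1 * e2)) + t j * φ (a * (e2 * e2)) := by
      have := hst j _ (hm _ h2 _ ha)
      rw [show e2 * (a * X j) = X j * (e2 * a) by ring, this]
      congr 3 <;> ring
    rw [a1, a2, a3, ← hu, ← huv, ← hv]
    simp only [x]; ring
  have hev : ∀ q ∈ formSpace n 2, φ (a * q) = eval x q := by
    intro q hq
    rw [← formSpace_mul n 1 1, span_one, Submodule.span_mul_span] at hq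
    induction hq using Submodule.span_induction with
    | mem y hy =>
      obtain ⟨_, ⟨i, rfl⟩, _, ⟨j, rfl⟩, rfl⟩ := hy
      simpa using hxx i j
    | zero => simp
    | add y z _ _ hy hz => rw [mul_add, map_add, map_add, hy, hz]
    | smul c y _ hy => rw [mul_smul_comm, map_smul, hy, smul_eval, smul_eq_mul]
  have hx0 : x = 0 := hbpf x fun p hp => by rw [← hev p (hU hp)]; exact hφ a ha p hp
  intro q hq
  rw [hev q hq, hx0]
  have : eval (0 : Fin n → ℂ) q = coeff 0 q := by
    rw [← constantCoeff_eq, eval_zero]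
  rw [this]
  exact IsHomogeneous.coeff_eq_zero (n := 2) hq (by simp)

lemma cubic (n : ℕ) (U : Submodule ℂ (PolyR n)) (hU : U ≤ formSpace n 2)
    (hbpf : IsBPF n U) (hcodim : vcodim n 2 U = 2)
    (φ : PolyR n →ₗ[ℂ] ℂ) (hφ : ∀ l ∈ formSpace n 1, ∀ u ∈ U, φ (l * u) = 0) :
    ∀ v ∈ formSpace n 1, ∀ q ∈ formSpace n 2, φ (v * q) = 0 := by
  let f : formSpace n 1 →ₗ[ℂ] Dual ℂ (formSpace n 2) :=
    ((LinearMap.mul ℂ (PolyR n)).compr₂ φ).compl₁₂ (formSpace n 1).subtype (formSpace n 2).subtype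
  have hf : ∀ v q, f v q = φ (v * q) := fun v q => rfl
  let U' : Submodule ℂ (formSpace n 2) := U.comap (formSpace n 2).subtype
  have hU' : finrank ℂ U' = finrank ℂ U :=
    (Submodule.comapSubtypeEquivOfLe hU).finrank_eq
  have hrange : LinearMap.range f ≤ U'.dualAnnihilator := by
    rintro _ ⟨v, rfl⟩
    rw [Submodule.mem_dualAnnihilator]
    intro w hw
    exact hφ _ v.2 _ hw
  have hr : finrank ℂ (LinearMap.range f) ≤ 2 := by
    have h1 := Submodule.finrank_mono hrange
    have h2 := Subspace.finrank_add_finrank_dualAnnihilator_eq U'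
    unfold vcodim at hcodim
    omega
  obtain ⟨⟨e1, h1⟩, ⟨e2, h2⟩, he⟩ := exists_two f hr
  have hspan : ∀ v ∈ formSpace n 1, ∃ s t : ℂ, ∀ q ∈ formSpace n 2,
      φ (v * q) = s * φ (e1 * q) + t * φ (e2 * q) := by
    intro v hv
    obtain ⟨s, t, hst⟩ := he ⟨v, hv⟩
    exact ⟨s, t, fun q hq => congrArg (fun g => g ⟨q, hq⟩) hst⟩
  have single : ∀ e ∈ formSpace n 1, (∀ v ∈ formSpace n 1, ∃ s : ℂ, ∀ q ∈ formSpace n 2,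
      φ (v * q) = s * φ (e * q)) → ∀ v ∈ formSpace n 1, ∀ q ∈ formSpace n 2, φ (v * q) = 0 := by
    intro e hee hs v hv q hq
    obtain ⟨s, hs'⟩ := hs v hv
    rw [hs' q hq, rank_one n U hU hbpf φ hφ e 0 hee (Submodule.zero_mem _) ?_ e hee (by simp) q hq,
      mul_zero]
    intro w hw
    obtain ⟨s, hs⟩ := hs w hw
    exact ⟨s, 0, fun q hq => by rw [hs q hq]; ring⟩
  obtain ⟨s, t, hst, hroot⟩ := exists_root
    (φ (e1 * (e1 * e1)) * φ (e1 * (e2 * e2)) - φ (e1 * (e1 * e2)) ^ 2)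
    (φ (e1 * (e1 * e1)) * φ (e2 * (e2 * e2)) + φ (e2 * (e1 * e1)) * φ (e1 * (e2 * e2))
      - 2 * φ (e1 * (e1 * e2)) * φ (e2 * (e1 * e2)))
    (φ (e2 * (e1 * e1)) * φ (e2 * (e2 * e2)) - φ (e2 * (e1 * e2)) ^ 2)
  have hexp : ∀ q, φ ((s • e1 + t • e2) * q) = s * φ (e1 * q) + t * φ (e2 * q) := by
    intro q; simp [add_mul]
  have hz := rank_one n U hU hbpf φ hφ e1 e2 h1 h2 hspan (s • e1 + t • e2)
    (Submodule.add_mem _ (Submodule.smul_mem _ _ h1) (Submodule.smul_mem _ _ h2))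
    (by rw [hexp, hexp, hexp]; linear_combination hroot)
  simp only [hexp] at hz
  rcases hst with hs | ht
  · refine single e2 h2 fun v hv => ?_
    obtain ⟨c, d, hcd⟩ := hspan v hv
    refine ⟨d - c * t / s, fun q hq => ?_⟩
    rw [hcd q hq]
    have := hz q hq
    field_simp
    linear_combination c * this
  · refine single e1 h1 fun v hv => ?_
    obtain ⟨c, d, hcd⟩ := hspan v hv
    refine ⟨c - d * s / t, fun q hq => ?_⟩
    rw [hcd q hq]
    have := hz q hq
    field_simp
    linear_combination d * this

lemma three_le (n : ℕ) (U : Submodule ℂ (PolyR n)) (hU : U ≤ formSpace n 2)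
    (hbpf : IsBPF n U) (hcodim : vcodim n 2 U = 2) :
    formSpace n 3 ≤ formSpace n 1 * U := by
  intro p hp
  by_contra hn
  obtain ⟨φ, hφ, hker⟩ := Submodule.exists_le_ker_of_notMem hn
  apply hφ
  have h0 := cubic n U hU hbpf hcodim φ fun l hl u hu =>
    hker (Submodule.mul_mem_mul hl hu)
  rw [show 3 = 1 + 2 from rfl, ← formSpace_mul] at hp
  have : formSpace n 1 * formSpace n 2 ≤ LinearMap.ker φ :=
    Submodule.mul_le.mpr fun v hv q hq => h0 v hv q hq
  exact this hp

lemma t_le (n : ℕ) (U : Submodule ℂ (PolyR n)) (hU : U ≤ formSpace n 2)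
    (hbpf : IsBPF n U) (hcodim : vcodim n 2 U = 2) (t : ℕ) (ht : 3 ≤ t) :
    idealComp n (Ideal.span (U : Set (PolyR n))) t = formSpace n t := by
  refine inf_eq_right.mpr ?_
  obtain ⟨k, rfl⟩ := Nat.exists_eq_add_of_le' ht
  rw [← formSpace_mul]
  refine Submodule.mul_le.mpr fun a _ b hb => ?_
  refine Ideal.mul_mem_left _ _ ?_
  have h3 : formSpace n 1 * U ≤ Submodule.restrictScalars ℂ (Ideal.span (U : Set (PolyR n))) :=
    Submodule.mul_le.mpr fun l _ u hu => Ideal.mul_mem_left _ _ (Ideal.subset_span hu)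
  exact h3 (three_le n U hU hbpf hcodim hb)

lemma low (n : ℕ) (U : Submodule ℂ (PolyR n)) (hU : U ≤ formSpace n 2) :
    idealComp n (Ideal.span (U : Set (PolyR n))) 0 = ⊥ ∧
    idealComp n (Ideal.span (U : Set (PolyR n))) 1 = ⊥ ∧
    idealComp n (Ideal.span (U : Set (PolyR n))) 2 = U := by
  have self : ∀ k p, p ∈ formSpace n k → homogeneousComponent k p = p := fun k p hp =>
    homogeneousComponent_eq_self hp
  refine ⟨?_, ?_, ?_⟩
  · rw [eq_bot_iff]; rintro p ⟨hp, hk⟩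
    rw [Submodule.mem_bot, ← self _ p hk]; exact (comp_mem n U hU p hp).1
  · rw [eq_bot_iff]; rintro p ⟨hp, hk⟩
    rw [Submodule.mem_bot, ← self _ p hk]; exact (comp_mem n U hU p hp).2.1
  · refine le_antisymm ?_ fun p hp => ⟨Ideal.subset_span hp, hU hp⟩
    rintro p ⟨hp, hk⟩
    rw [← self _ p hk]; exact (comp_mem n U hU p hp).2.2

end Stmt15

theorem stmt15 (n : ℕ) (hn : 2 ≤ n)
    (U : Submodule ℂ (PolyR n)) (hU : U ≤ formSpace n 2)
    (hbpf : IsBPF n U) (hcodim : vcodim n 2 U = 2) :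
    hilb n (Ideal.span (U : Set (PolyR n))) 0 = 1 ∧
    hilb n (Ideal.span (U : Set (PolyR n))) 1 = n ∧
    hilb n (Ideal.span (U : Set (PolyR n))) 2 = 2 ∧
    ∀ t : ℕ, 3 ≤ t → hilb n (Ideal.span (U : Set (PolyR n))) t = 0 := by
  obtain ⟨l0, l1, l2⟩ := Stmt15.low n U hU
  refine ⟨?_, ?_, ?_, fun t ht => ?_⟩
  · rw [hilb, l0, Stmt15.finrank_zero, finrank_bot]
  · rw [hilb, l1, Stmt15.finrank_one, finrank_bot, Nat.sub_zero]
  · rw [hilb, l2]; exact hcodim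
  · rw [hilb, Stmt15.t_le n U hU hbpf hcodim t ht, Nat.sub_self]
end

section
/- Let U ⊆ A(n)_d be a base-point-free linear subspace of codimension k ∈ {1, 2} with codim U² = s. Then for every N ≥ n there exists a base-point-free linear subspace V ⊆ A(N)_d of codimension k with codim_{A(N)_{2d}} V² = s. -/
open MvPolynomial Module

lemma formSpace_mul (n a b : ℕ) : formSpace n a * formSpace n b = formSpace n (a + b) := by
  unfold formSpace
  rw [← homogeneousSubmodule_one_pow (σ := Fin n) (R := ℂ) a, ← homogeneousSubmodule_one_pow (σ := Fin n) (R := ℂ) b,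
    ← homogeneousSubmodule_one_pow (σ := Fin n) (R := ℂ) (a + b), pow_add]

lemma mul_mem_form {n a b c : ℕ} {f g : PolyR n} (hf : f ∈ formSpace n a)
    (hg : g ∈ formSpace n b) (h : a + b = c) : f * g ∈ formSpace n c := by
  subst h
  rw [← formSpace_mul]
  exact Submodule.mul_mem_mul hf hg

lemma X_mem_form {n : ℕ} (i : Fin n) : (X i : PolyR n) ∈ formSpace n 1 :=
  isHomogeneous_X ℂ i

lemma form_le_of {n a b c : ℕ} (h : a + b = c) (S : Submodule ℂ (PolyR n))
    (hS : ∀ f ∈ formSpace n a, ∀ g ∈ formSpace n b, f * g ∈ S) : formSpace n c ≤ S := by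
  subst h
  rw [← formSpace_mul]
  exact Submodule.mul_le.2 hS

lemma form_succ_le {n e : ℕ} (S : Submodule ℂ (PolyR n))
    (hS : ∀ i, ∀ g ∈ formSpace n e, X i * g ∈ S) : formSpace n (e + 1) ≤ S := by
  refine form_le_of (a := 1) (b := e) (by omega) S ?_
  intro f hf g hg
  have h1 : formSpace n 1 ≤ Submodule.comap (LinearMap.mulRight ℂ g) S := by
    unfold formSpace
    rw [homogeneousSubmodule_one_eq_span_X, Submodule.span_le]
    rintro _ ⟨i, rfl⟩
    simpa using hS i g hg
  simpa using h1 hf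

instance form_fin (n d : ℕ) : FiniteDimensional ℂ (formSpace n d) :=
  Module.Finite.iff_fg.2 (homogeneousSubmodule_fg (Fin n) ℂ d)

lemma eval_contra {n e : ℕ} (U : Submodule ℂ (PolyR n)) (hU : U ≤ formSpace n (e + 1))
    (hbpf : IsBPF n U) (w : PolyR n →ₗ[ℂ] ℂ) (x : Fin n → ℂ) (μ : PolyR n → ℂ)
    (h : ∀ i, ∀ b ∈ formSpace n e, w (X i * b) = x i * μ b)
    (hw : ∃ f ∈ formSpace n (e + 1), w f ≠ 0) (hwU : ∀ f ∈ U, w f = 0) : False := by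
  have hx : ∃ i, x i ≠ 0 := by
    by_contra! hx
    obtain ⟨f, hf, hf0⟩ := hw
    have : formSpace n (e + 1) ≤ LinearMap.ker w := by
      apply form_succ_le
      intro i g hg
      simp [h i g hg, hx i]
    exact hf0 (this hf)
  obtain ⟨i0, hi0⟩ := hx
  have key : ∀ j k, j + k = e + 1 → ∀ f ∈ formSpace n j,
      w (f * X i0 ^ k) * x i0 ^ j = eval x f * w (X i0 ^ (e + 1)) := by
    intro j
    induction j with
    | zero =>
      intro k hk f hf
      obtain rfl : k = e + 1 := by omega
      have : f.IsHomogeneous 0 := hf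
      rw [← totalDegree_zero_iff_isHomogeneous, totalDegree_eq_zero_iff_eq_C] at this
      rw [this]
      simp [C_mul']
    | succ j ih =>
      intro k hk f hf
      let L : PolyR n →ₗ[ℂ] ℂ := (x i0 ^ (j+1)) • (w ∘ₗ LinearMap.mulRight ℂ (X i0 ^ k))
        - (w (X i0 ^ (e + 1))) • (aeval x : PolyR n →ₐ[ℂ] ℂ).toLinearMap
      have hL : formSpace n (j + 1) ≤ LinearMap.ker L := by
        apply form_succ_le
        intro i g hg
        have h1 := ih (k + 1) (by omega) g hg
        have hm : g * X i0 ^ k ∈ formSpace n e :=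
          mul_mem_form hg (isHomogeneous_X_pow i0 k : (X i0 ^ k : PolyR n).IsHomogeneous k)
            (by omega)
        have h2 := h i _ hm
        have h3 := h i0 _ hm
        have e1 : g * X i0 ^ (k + 1) = X i0 * (g * X i0 ^ k) := by ring
        have e2 : X i * g * X i0 ^ k = X i * (g * X i0 ^ k) := by ring
        rw [e1, h3] at h1
        have e3 : (aeval x) g = eval x g := by simp [aeval_eq_eval]
        simp only [LinearMap.mem_ker, L, LinearMap.sub_apply, LinearMap.smul_apply,
          LinearMap.comp_apply, LinearMap.mulRight_apply, e2, h2, AlgHom.toLinearMap_apply,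
          map_mul, aeval_X, smul_eq_mul, e3]
        linear_combination x i * h1
      have h4 := hL hf
      have e3 : (aeval x) f = eval x f := by simp [aeval_eq_eval]
      simp only [LinearMap.mem_ker, L, LinearMap.sub_apply, LinearMap.smul_apply,
          LinearMap.comp_apply, LinearMap.mulRight_apply, AlgHom.toLinearMap_apply,
          smul_eq_mul, e3] at h4
      linear_combination h4
  have hw0 : w (X i0 ^ (e + 1)) ≠ 0 := by
    intro h0
    obtain ⟨f, hf, hf0⟩ := hw
    have := key (e + 1) 0 rfl f hf
    rw [h0] at this
    simp [hi0, hf0] at this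
  refine hi0 (congrFun (hbpf x ?_) i0)
  intro p hp
  have := key (e + 1) 0 rfl p (hU hp)
  simpa [hwU p hp, hw0] using this

/-- One-dimensional case. -/
lemma rank_one {n e : ℕ} (U : Submodule ℂ (PolyR n)) (hU : U ≤ formSpace n (e + 1))
    (hbpf : IsBPF n U) (φ : PolyR n →ₗ[ℂ] ℂ) (g : PolyR n) (hg : g ∈ formSpace n (e + 1))
    (hφ : ∃ a ∈ formSpace n e, ∃ f ∈ formSpace n (e + 1), φ (a * f) ≠ 0)
    (hUφ : ∀ f ∈ U, ∀ a ∈ formSpace n e, φ (a * f) = 0)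
    (hspan : ∀ f ∈ formSpace n (e + 1), ∃ c : ℂ, ∀ a ∈ formSpace n e,
      φ (a * f) = c * φ (a * g)) : False := by
  obtain ⟨a, ha, f, hf, hne⟩ := hφ
  obtain ⟨c, hc⟩ := hspan f hf
  have hag : φ (a * g) ≠ 0 := by
    intro h0
    rw [hc a ha, h0] at hne
    simp at hne
  have hl : ∀ i, ∃ c : ℂ, ∀ b ∈ formSpace n e, φ (b * (X i * a)) = c * φ (b * g) := fun i =>
    hspan _ (mul_mem_form (X_mem_form i) ha (by omega))
  choose x hx using hl
  refine eval_contra U hU hbpf (φ ∘ₗ LinearMap.mulLeft ℂ a) x (fun b => φ (b * g)) ?_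
    ⟨g, hg, by simpa using hag⟩ (fun f hf => by simpa using hUφ f hf a ha)
  intro i b hb
  rw [← hx i b hb]
  simp only [LinearMap.comp_apply, LinearMap.mulLeft_apply]
  congr 1
  ring

lemma quad_factor (α β γ : ℂ) (h : α ≠ 0 ∨ β ≠ 0 ∨ γ ≠ 0) :
    ∃ s t u v : ℂ, (s ≠ 0 ∨ t ≠ 0) ∧ (u ≠ 0 ∨ v ≠ 0) ∧
      s * u = α ∧ s * v + t * u = β ∧ t * v = γ := by
  by_cases hα : α = 0
  · exact ⟨0, 1, β, γ, by simp, by simpa [hα] using h, by simp [hα], by ring, by ring⟩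
  · obtain ⟨r, hr⟩ := IsAlgClosed.exists_pow_nat_eq (discrim α β γ) (n := 2) (by norm_num)
    obtain ⟨z, hz⟩ := exists_quadratic_eq_zero hα ⟨r, by rw [← hr]; ring⟩
    exact ⟨1, -z, α, β + z * α, by simp, by simp [hα], by ring, by ring,
      by linear_combination -hz⟩

lemma exists_relation {M W : Type*} [AddCommGroup M] [Module ℂ M] [AddCommGroup W] [Module ℂ W]
    (P : Submodule ℂ M) (T : M →ₗ[ℂ] W) :
    (∀ v : W, ∃ a ∈ P, T a = v) ∨ ∃ F : W →ₗ[ℂ] ℂ, F ≠ 0 ∧ ∀ a ∈ P, F (T a) = 0 := by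
  by_cases h : Submodule.map T P = ⊤
  · left
    intro v
    have : v ∈ Submodule.map T P := h ▸ Submodule.mem_top
    simpa using this
  · right
    obtain ⟨F, hF, hle⟩ := Submodule.exists_le_ker_of_lt_top _ (lt_top_iff_ne_top.2 h)
    exact ⟨F, hF, fun a ha => hle (Submodule.mem_map_of_mem ha)⟩

lemma exists_relation_two {M : Type*} [AddCommGroup M] [Module ℂ M]
    (P : Submodule ℂ M) (p q : M →ₗ[ℂ] ℂ) :
    (∀ x y : ℂ, ∃ a ∈ P, p a = x ∧ q a = y) ∨
      ∃ c₁ c₂ : ℂ, (c₁ ≠ 0 ∨ c₂ ≠ 0) ∧ ∀ a ∈ P, c₁ * p a + c₂ * q a = 0 := by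
  have key : ∀ (F : ℂ × ℂ →ₗ[ℂ] ℂ) (x y : ℂ), F (x, y) = F (1, 0) * x + F (0, 1) * y := by
    intro F x y
    have : ((x, y) : ℂ × ℂ) = x • (1, 0) + y • (0, 1) := by simp
    rw [this, map_add, map_smul, map_smul]
    simp only [smul_eq_mul]; ring
  rcases exists_relation P (p.prod q) with h | ⟨F, hF, h⟩
  · left
    intro x y
    obtain ⟨a, ha, h⟩ := h (x, y)
    simp at h
    exact ⟨a, ha, h⟩
  · right
    refine ⟨F (1, 0), F (0, 1), ?_, fun a ha => ?_⟩
    · by_contra! h0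
      apply hF
      apply LinearMap.ext
      rintro ⟨x, y⟩
      rw [key, h0.1, h0.2]; simp
    · rw [← key]; exact h a ha

lemma exists_relation_three {M : Type*} [AddCommGroup M] [Module ℂ M]
    (P : Submodule ℂ M) (p q r : M →ₗ[ℂ] ℂ) :
    (∀ x y z : ℂ, ∃ a ∈ P, p a = x ∧ q a = y ∧ r a = z) ∨
      ∃ c₁ c₂ c₃ : ℂ, (c₁ ≠ 0 ∨ c₂ ≠ 0 ∨ c₃ ≠ 0) ∧
        ∀ a ∈ P, c₁ * p a + c₂ * q a + c₃ * r a = 0 := by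
  have key : ∀ (F : ℂ × ℂ × ℂ →ₗ[ℂ] ℂ) (x y z : ℂ),
      F (x, y, z) = F (1, 0, 0) * x + F (0, 1, 0) * y + F (0, 0, 1) * z := by
    intro F x y z
    have : ((x, y, z) : ℂ × ℂ × ℂ) = x • (1, 0, 0) + y • (0, 1, 0) + z • (0, 0, 1) := by simp
    rw [this, map_add, map_add, map_smul, map_smul, map_smul]
    simp only [smul_eq_mul]; ring
  rcases exists_relation P (p.prod (q.prod r)) with h | ⟨F, hF, h⟩
  · left
    intro x y z
    obtain ⟨a, ha, h⟩ := h (x, y, z)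
    simp at h
    exact ⟨a, ha, h⟩
  · right
    refine ⟨F (1, 0, 0), F (0, 1, 0), F (0, 0, 1), ?_, fun a ha => ?_⟩
    · by_contra! h0
      apply hF
      apply LinearMap.ext
      rintro ⟨x, y, z⟩
      rw [key, h0.1, h0.2.1, h0.2.2]; simp
    · rw [← key]; exact h a ha

lemma rank_two {n m : ℕ} (U : Submodule ℂ (PolyR n)) (hU : U ≤ formSpace n (m + 2))
    (hbpf : IsBPF n U) (φ : PolyR n →ₗ[ℂ] ℂ) (g₁ g₂ : PolyR n)
    (hg₁ : g₁ ∈ formSpace n (m + 2)) (hg₂ : g₂ ∈ formSpace n (m + 2))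
    (hφ : ∃ a ∈ formSpace n (m + 1), ∃ f ∈ formSpace n (m + 2), φ (a * f) ≠ 0)
    (hUφ : ∀ f ∈ U, ∀ a ∈ formSpace n (m + 1), φ (a * f) = 0)
    (hspan : ∀ f ∈ formSpace n (m + 2), ∃ c₁ c₂ : ℂ, ∀ a ∈ formSpace n (m + 1),
      φ (a * f) = c₁ * φ (a * g₁) + c₂ * φ (a * g₂)) : False := by
  rcases exists_relation_two (formSpace n (m + 1)) (φ ∘ₗ LinearMap.mulRight ℂ g₁)
    (φ ∘ₗ LinearMap.mulRight ℂ g₂) with hsurj | ⟨c₁, c₂, hc, hrel⟩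
  swap
  · simp only [LinearMap.comp_apply, LinearMap.mulRight_apply] at hrel
    rcases hc with hc | hc
    · refine rank_one U hU hbpf φ g₂ hg₂ hφ hUφ ?_
      intro f hf
      obtain ⟨x, y, hxy⟩ := hspan f hf
      refine ⟨y - x * (c₂ / c₁), fun a ha => ?_⟩
      rw [hxy a ha]
      have := hrel a ha
      field_simp
      linear_combination x * this
    · refine rank_one U hU hbpf φ g₁ hg₁ hφ hUφ ?_
      intro f hf
      obtain ⟨x, y, hxy⟩ := hspan f hf
      refine ⟨x - y * (c₁ / c₂), fun a ha => ?_⟩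
      rw [hxy a ha]
      have := hrel a ha
      field_simp
      linear_combination y * this
  simp only [LinearMap.comp_apply, LinearMap.mulRight_apply] at hsurj
  obtain ⟨e₁, he₁, h11, h12⟩ := hsurj 1 0
  obtain ⟨e₂, he₂, h21, h22⟩ := hsurj 0 1
  clear hsurj
  have hdec : ∀ a ∈ formSpace n (m + 1), ∀ f ∈ formSpace n (m + 2),
      φ (a * f) = φ (a * g₁) * φ (e₁ * f) + φ (a * g₂) * φ (e₂ * f) := by
    intro a ha f hf
    obtain ⟨x, y, hxy⟩ := hspan f hf
    rw [hxy a ha, hxy e₁ he₁, hxy e₂ he₂, h11, h12, h21, h22]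
    ring
  have hX : ∀ {l b : PolyR n}, l ∈ formSpace n 1 → b ∈ formSpace n (m + 1) →
      l * b ∈ formSpace n (m + 2) := fun hl hb => mul_mem_form hl hb (by omega)
  rcases exists_relation_three (formSpace n 1) (φ ∘ₗ LinearMap.mulRight ℂ (e₁ * e₁))
    (φ ∘ₗ LinearMap.mulRight ℂ (e₁ * e₂)) (φ ∘ₗ LinearMap.mulRight ℂ (e₂ * e₂))
    with hsurj | ⟨α, β, γ, hne, hrel⟩
  · simp only [LinearMap.comp_apply, LinearMap.mulRight_apply] at hsurj
    obtain ⟨l₁, hl₁, p₁, q₁, r₁⟩ := hsurj 1 0 0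
    obtain ⟨l₂, hl₂, p₂, q₂, r₂⟩ := hsurj 0 1 0
    obtain ⟨l₃, hl₃, p₃, q₃, r₃⟩ := hsurj 0 0 1
    -- the two coordinates of `φ (l * l' * m * e_k)`
    have hA : ∀ l ∈ formSpace n 1, ∀ l' ∈ formSpace n 1, ∀ c ∈ formSpace n m,
        φ (l * l' * c * e₁) = φ (l' * c * g₁) * φ (l * (e₁ * e₁))
          + φ (l' * c * g₂) * φ (l * (e₁ * e₂)) := by
      intro l hl l' hl' c hc
      have := hdec (l' * c) (mul_mem_form hl' hc (by omega)) (l * e₁) (hX hl he₁)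
      rw [show l * l' * c * e₁ = l' * c * (l * e₁) by ring, this,
        show e₁ * (l * e₁) = l * (e₁ * e₁) by ring, show e₂ * (l * e₁) = l * (e₁ * e₂) by ring]
    have hB : ∀ l ∈ formSpace n 1, ∀ l' ∈ formSpace n 1, ∀ c ∈ formSpace n m,
        φ (l * l' * c * e₂) = φ (l' * c * g₁) * φ (l * (e₁ * e₂))
          + φ (l' * c * g₂) * φ (l * (e₂ * e₂)) := by
      intro l hl l' hl' c hc
      have := hdec (l' * c) (mul_mem_form hl' hc (by omega)) (l * e₂) (hX hl he₂)
      rw [show l * l' * c * e₂ = l' * c * (l * e₂) by ring, this,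
        show e₁ * (l * e₂) = l * (e₁ * e₂) by ring, show e₂ * (l * e₂) = l * (e₂ * e₂) by ring]
    have hA' : ∀ l ∈ formSpace n 1, ∀ l' ∈ formSpace n 1, ∀ c ∈ formSpace n m,
        φ (l' * c * g₁) * φ (l * (e₁ * e₁)) + φ (l' * c * g₂) * φ (l * (e₁ * e₂)) =
        φ (l * c * g₁) * φ (l' * (e₁ * e₁)) + φ (l * c * g₂) * φ (l' * (e₁ * e₂)) := by
      intro l hl l' hl' c hc
      rw [← hA l hl l' hl' c hc, ← hA l' hl' l hl c hc, mul_comm l l']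
    have hB' : ∀ l ∈ formSpace n 1, ∀ l' ∈ formSpace n 1, ∀ c ∈ formSpace n m,
        φ (l' * c * g₁) * φ (l * (e₁ * e₂)) + φ (l' * c * g₂) * φ (l * (e₂ * e₂)) =
        φ (l * c * g₁) * φ (l' * (e₁ * e₂)) + φ (l * c * g₂) * φ (l' * (e₂ * e₂)) := by
      intro l hl l' hl' c hc
      rw [← hB l hl l' hl' c hc, ← hB l' hl' l hl c hc, mul_comm l l']
    have hz : ∀ l ∈ formSpace n 1, ∀ c ∈ formSpace n m, φ (l * c * g₁) = 0 := by
      intro l hl c hc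
      have a12 := hA' l₁ hl₁ l₂ hl₂ c hc
      have b12 := hB' l₁ hl₁ l₂ hl₂ c hc
      have a13 := hA' l₁ hl₁ l₃ hl₃ c hc
      have b13 := hB' l₁ hl₁ l₃ hl₃ c hc
      have a1 := hA' l₁ hl₁ l hl c hc
      simp only [p₁, p₂, p₃, q₁, q₂, q₃, r₁, r₂, r₃, mul_one, mul_zero, add_zero, zero_add]
        at a12 b12 a13 b13 a1
      rw [a1, ← b12, ← b13]; simp
    have hle : formSpace n (m + 1) ≤ LinearMap.ker (φ ∘ₗ LinearMap.mulRight ℂ g₁) := by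
      refine form_le_of (a := 1) (b := m) (by omega) _ ?_
      intro l hl c hc
      simpa using hz l hl c hc
    have := hle he₁
    simp [h11] at this
  · simp only [LinearMap.comp_apply, LinearMap.mulRight_apply] at hrel
    obtain ⟨s, t, u, v, hst, huv, rfl, rfl, rfl⟩ := quad_factor α β γ hne
    have ha : s • e₁ + t • e₂ ∈ formSpace n (m + 1) :=
      Submodule.add_mem _ (Submodule.smul_mem _ _ he₁) (Submodule.smul_mem _ _ he₂)
    have hexp : ∀ f : PolyR n, φ ((s • e₁ + t • e₂) * f) = s * φ (e₁ * f) + t * φ (e₂ * f) := by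
      intro f
      simp [add_mul]
    have hne' : ∃ f ∈ formSpace n (m + 1 + 1), φ ((s • e₁ + t • e₂) * f) ≠ 0 := by
      rcases hst with h | h
      · exact ⟨g₁, hg₁, by rw [hexp, h11, h21]; simpa using h⟩
      · exact ⟨g₂, hg₂, by rw [hexp, h12, h22]; simpa using h⟩
    have hform : ∀ l ∈ formSpace n 1, ∀ b ∈ formSpace n (m + 1),
        φ ((s • e₁ + t • e₂) * (l * b)) =
          φ (b * g₁) * (s * φ (l * (e₁ * e₁)) + t * φ (l * (e₁ * e₂))) +
          φ (b * g₂) * (s * φ (l * (e₁ * e₂)) + t * φ (l * (e₂ * e₂))) := by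
      intro l hl b hb
      have k1 := hdec b hb (l * e₁) (hX hl he₁)
      have k2 := hdec b hb (l * e₂) (hX hl he₂)
      rw [hexp, show e₁ * (l * b) = b * (l * e₁) by ring,
        show e₂ * (l * b) = b * (l * e₂) by ring, k1, k2,
        show e₁ * (l * e₁) = l * (e₁ * e₁) by ring, show e₂ * (l * e₁) = l * (e₁ * e₂) by ring,
        show e₁ * (l * e₂) = l * (e₁ * e₂) by ring, show e₂ * (l * e₂) = l * (e₂ * e₂) by ring]
      ring
    rcases huv with h | h
    · refine eval_contra U hU hbpf (φ ∘ₗ LinearMap.mulLeft ℂ (s • e₁ + t • e₂))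
        (fun i => s * φ (X i * (e₁ * e₂)) + t * φ (X i * (e₂ * e₂)))
        (fun b => φ (b * g₂) - φ (b * g₁) * (v / u)) ?_
        (by simpa using hne') (fun f hf => by simpa using hUφ f hf _ ha)
      intro i b hb
      have h1 := hrel (X i) (X_mem_form i)
      simp only [LinearMap.comp_apply, LinearMap.mulLeft_apply]
      rw [hform _ (X_mem_form i) b hb]
      field_simp
      linear_combination φ (b * g₁) * h1
    · refine eval_contra U hU hbpf (φ ∘ₗ LinearMap.mulLeft ℂ (s • e₁ + t • e₂))
        (fun i => s * φ (X i * (e₁ * e₁)) + t * φ (X i * (e₁ * e₂)))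
        (fun b => φ (b * g₁) - φ (b * g₂) * (u / v)) ?_
        (by simpa using hne') (fun f hf => by simpa using hUφ f hf _ ha)
      intro i b hb
      have h1 := hrel (X i) (X_mem_form i)
      simp only [LinearMap.comp_apply, LinearMap.mulLeft_apply]
      rw [hform _ (X_mem_form i) b hb]
      field_simp
      linear_combination φ (b * g₂) * h1

lemma exists_one_more {M : Type*} [AddCommGroup M] [Module ℂ M] (A U : Submodule ℂ M)
    [FiniteDimensional ℂ A] (hU : U ≤ A) (j : ℕ) (h : finrank ℂ A ≤ finrank ℂ U + (j + 1)) :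
    ∃ g ∈ A, finrank ℂ A ≤ finrank ℂ (U ⊔ Submodule.span ℂ {g} : Submodule ℂ M) + j := by
  by_cases hA : A ≤ U
  · refine ⟨0, A.zero_mem, ?_⟩
    have hAU := le_antisymm hA hU
    have h0 : U ⊔ Submodule.span ℂ {(0 : M)} = A := by
      rw [hAU]; exact sup_eq_left.2 (by simp)
    rw [h0]
    exact Nat.le_add_right _ _
  · obtain ⟨g, hg, hgU⟩ := Set.not_subset.1 hA
    refine ⟨g, hg, ?_⟩
    have hle : U ⊔ Submodule.span ℂ {g} ≤ A := sup_le hU (by simpa using hg)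
    have hfin : FiniteDimensional ℂ (U ⊔ Submodule.span ℂ {g} : Submodule ℂ M) :=
      Submodule.finiteDimensional_of_le hle
    have hlt : U < U ⊔ Submodule.span ℂ {g} := by
      refine lt_of_le_of_ne le_sup_left ?_
      intro h
      apply hgU
      have : g ∈ U ⊔ Submodule.span ℂ {g} :=
        Submodule.mem_sup_right (Submodule.mem_span_singleton_self g)
      rw [← h] at this
      exact this
    have := Submodule.finrank_lt_finrank_of_lt hlt
    omega

lemma exists_two_more {M : Type*} [AddCommGroup M] [Module ℂ M] (A U : Submodule ℂ M)
    [FiniteDimensional ℂ A] (hU : U ≤ A) (h : finrank ℂ A ≤ finrank ℂ U + 2) :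
    ∃ g₁ ∈ A, ∃ g₂ ∈ A, ∀ f ∈ A, ∃ c₁ c₂ : ℂ, f - c₁ • g₁ - c₂ • g₂ ∈ U := by
  obtain ⟨g₁, hg₁, h1⟩ := exists_one_more A U hU 1 h
  have hle1 : U ⊔ Submodule.span ℂ {g₁} ≤ A := sup_le hU (by simpa using hg₁)
  obtain ⟨g₂, hg₂, h2⟩ := exists_one_more A _ hle1 0 h1
  have hle2 : U ⊔ Submodule.span ℂ {g₁} ⊔ Submodule.span ℂ {g₂} ≤ A :=
    sup_le hle1 (by simpa using hg₂)
  have heq := Submodule.eq_of_le_of_finrank_le hle2 h2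
  refine ⟨g₁, hg₁, g₂, hg₂, fun f hf => ?_⟩
  rw [← heq] at hf
  obtain ⟨y, hy, z, hz, rfl⟩ := Submodule.mem_sup.1 hf
  obtain ⟨y', hy', z', hz', rfl⟩ := Submodule.mem_sup.1 hy
  obtain ⟨c₁, rfl⟩ := Submodule.mem_span_singleton.1 hz'
  obtain ⟨c₂, rfl⟩ := Submodule.mem_span_singleton.1 hz
  exact ⟨c₁, c₂, by simpa [add_sub_assoc, add_sub_cancel_right] using hy'⟩

/-- Key proposition: `A_{2d-1} ⊆ A_{d-1} U`. -/
lemma key_prop {n m : ℕ} (U : Submodule ℂ (PolyR n)) (hU : U ≤ formSpace n (m + 2))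
    (hbpf : IsBPF n U) (h : finrank ℂ (formSpace n (m + 2)) ≤ finrank ℂ U + 2) :
    formSpace n (m + 1 + (m + 2)) ≤ formSpace n (m + 1) * U := by
  by_contra hnot
  obtain ⟨f₀, hf₀, hf₀U⟩ := Set.not_subset.1 hnot
  obtain ⟨φ, hφ, hle⟩ := Submodule.exists_le_ker_of_notMem hf₀U
  obtain ⟨g₁, hg₁, g₂, hg₂, hg⟩ := exists_two_more _ U hU h
  have hUφ : ∀ f ∈ U, ∀ a ∈ formSpace n (m + 1), φ (a * f) = 0 := fun f hf a ha =>
    hle (Submodule.mul_mem_mul ha hf)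
  refine rank_two U hU hbpf φ g₁ g₂ hg₁ hg₂ ?_ hUφ ?_
  · by_contra! h0
    have : formSpace n (m + 1 + (m + 2)) ≤ LinearMap.ker φ := form_le_of rfl _ h0
    exact hφ (this hf₀)
  · intro f hf
    obtain ⟨c₁, c₂, hc⟩ := hg f hf
    refine ⟨c₁, c₂, fun a ha => ?_⟩
    have := hUφ _ hc a ha
    simp only [mul_sub, map_sub, mul_smul_comm, map_smul, smul_eq_mul] at this
    linear_combination this

/-- set the extra variables to zero -/
noncomputable def resHom (n N : ℕ) : PolyR N →ₐ[ℂ] PolyR n :=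
  aeval (fun i : Fin N => if h : (i : ℕ) < n then X ⟨i, h⟩ else 0)

noncomputable def incHom {n N : ℕ} (h : n ≤ N) : PolyR n →ₐ[ℂ] PolyR N := rename (Fin.castLE h)

lemma res_inc {n N : ℕ} (h : n ≤ N) (f : PolyR n) : resHom n N (incHom h f) = f := by
  have : (resHom n N).comp (incHom h) = AlgHom.id ℂ _ := by
    apply MvPolynomial.algHom_ext
    intro i
    simp [resHom, incHom]
  exact congrArg (fun F => F f) this

lemma res_X_ge {n N : ℕ} (j : Fin N) (hj : n ≤ (j : ℕ)) : resHom n N (X j) = 0 := by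
  simp [resHom, hj]

lemma inc_res_X_lt {n N : ℕ} (h : n ≤ N) (j : Fin N) (hj : (j : ℕ) < n) :
    incHom h (resHom n N (X j)) = X j := by
  simp [resHom, incHom, hj]

lemma inc_mem {n N d : ℕ} (h : n ≤ N) {f : PolyR n} (hf : f ∈ formSpace n d) :
    incHom h f ∈ formSpace N d :=
  IsHomogeneous.rename_isHomogeneous (f := Fin.castLE h) hf

lemma res_mem {n N d : ℕ} {f : PolyR N} (hf : f ∈ formSpace N d) :
    resHom n N f ∈ formSpace n d := by
  have : (resHom n N f).IsHomogeneous (1 * d) := by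
    refine IsHomogeneous.aeval (m := d) (n := 1) hf _ ?_
    intro i
    by_cases h : (i : ℕ) < n
    · simpa [h] using isHomogeneous_X ℂ _
    · simpa [h] using isHomogeneous_zero _ _ _
  rw [one_mul] at this
  exact this

lemma sub_inc_res {n N : ℕ} (h : n ≤ N) (e : ℕ) (f : PolyR N) (hf : f ∈ formSpace N (e + 1))
    (S : Submodule ℂ (PolyR N))
    (hS : ∀ j : Fin N, n ≤ (j : ℕ) → ∀ g ∈ formSpace N e, X j * g ∈ S) :
    f - incHom h (resHom n N f) ∈ S := by
  induction e generalizing f S with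
  | zero =>
    have : formSpace N (0 + 1) ≤ Submodule.comap (LinearMap.id -
        ((incHom h).comp (resHom n N)).toLinearMap) S := by
      apply form_succ_le
      intro i g hg
      have hg' : g.IsHomogeneous 0 := hg
      rw [← totalDegree_zero_iff_isHomogeneous, totalDegree_eq_zero_iff_eq_C] at hg'
      by_cases hi : (i : ℕ) < n
      · have h1 := inc_res_X_lt h i hi
        rw [hg']
        simp [h1]
      · have h1 := res_X_ge i (not_lt.1 hi)
        simpa [h1] using hS i (not_lt.1 hi) g hg
    simpa using this hf
  | succ e ih =>
    have : formSpace N (e + 1 + 1) ≤ Submodule.comap (LinearMap.id -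
        ((incHom h).comp (resHom n N)).toLinearMap) S := by
      apply form_succ_le
      intro i g hg
      by_cases hi : (i : ℕ) < n
      · have h1 := inc_res_X_lt h i hi
        have h2 := ih g hg (Submodule.comap (LinearMap.mulLeft ℂ (X i)) S) (by
          intro j hj g hg
          have := hS j hj (X i * g) (mul_mem_form (X_mem_form i) hg (by omega))
          simpa [mul_left_comm] using this)
        simpa [h1, mul_sub] using h2
      · have h1 := res_X_ge i (not_lt.1 hi)
        simpa [h1] using hS i (not_lt.1 hi) g hg
    simpa using this hf

lemma vcodim_pull {n N : ℕ} (h : n ≤ N) (d : ℕ) (U : Submodule ℂ (PolyR n))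
    (hU : U ≤ formSpace n d) :
    vcodim N d (formSpace N d ⊓ Submodule.comap (resHom n N).toLinearMap U) = vcodim n d U := by
  set π := (resHom n N).toLinearMap with hπ
  have gen : ∀ W : Submodule ℂ (PolyR n), W ≤ formSpace n d →
      finrank ℂ (formSpace N d ⊓ Submodule.comap π W : Submodule ℂ (PolyR N)) =
        finrank ℂ W + finrank ℂ (formSpace N d ⊓ LinearMap.ker π : Submodule ℂ (PolyR N)) := by
    intro W hW
    set B : Submodule ℂ (PolyR N) := formSpace N d ⊓ Submodule.comap π W with hB
    have hfin : FiniteDimensional ℂ B := Submodule.finiteDimensional_of_le (inf_le_left)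
    have h1 := LinearMap.finrank_range_add_finrank_ker (π.domRestrict B)
    have h2 : LinearMap.range (π.domRestrict B) = W := by
      rw [LinearMap.range_domRestrict]
      apply le_antisymm
      · rintro _ ⟨f, hf, rfl⟩
        exact hf.2
      · intro w hw
        refine ⟨incHom h w, ⟨inc_mem h (hW hw), ?_⟩, ?_⟩
        · simpa [hπ, res_inc] using hw
        · simp [hπ, res_inc]
    have h3 : (LinearMap.ker (π.domRestrict B)).map B.subtype = formSpace N d ⊓ LinearMap.ker π := by
      ext f
      constructor
      · rintro ⟨⟨g, hg⟩, hk, rfl⟩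
        exact ⟨hg.1, hk⟩
      · rintro ⟨hf, hk⟩
        refine ⟨⟨f, hf, ?_⟩, hk, rfl⟩
        have : π f = 0 := hk
        simp [this]
    rw [← h3, LinearEquiv.finrank_eq
      (Submodule.equivMapOfInjective B.subtype B.injective_subtype _).symm, ← h1, h2]
  have h1 := gen U hU
  have h2 := gen (formSpace n d) le_rfl
  have h3 : formSpace N d ⊓ Submodule.comap π (formSpace n d) = formSpace N d :=
    inf_eq_left.2 (fun f hf => res_mem hf)
  rw [h3] at h2
  unfold vcodim
  rw [h1, h2]
  omega

theorem stmt16 (n d k s N : ℕ) (hn : 2 ≤ n) (hd : 2 ≤ d) (hk : k = 1 ∨ k = 2)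
    (U : Submodule ℂ (PolyR n)) (hU : U ≤ formSpace n d) (hbpf : IsBPF n U)
    (hcodim : vcodim n d U = k) (hs : vcodim n (2 * d) (U * U) = s) (hN : n ≤ N) :
    ∃ V : Submodule ℂ (PolyR N), V ≤ formSpace N d ∧ IsBPF N V ∧
      vcodim N d V = k ∧ vcodim N (2 * d) (V * V) = s := by
  obtain ⟨m, rfl⟩ : ∃ m, d = m + 2 := ⟨d - 2, by omega⟩
  set V : Submodule ℂ (PolyR N) :=
    formSpace N (m + 2) ⊓ Submodule.comap (resHom n N).toLinearMap U with hV
  have hVle : V ≤ formSpace N (m + 2) := inf_le_left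
  have hVcod : vcodim N (m + 2) V = k := by rw [hV, vcodim_pull hN _ U hU, hcodim]
  have hincV : ∀ p ∈ U, incHom hN p ∈ V := fun p hp =>
    ⟨inc_mem hN (hU hp), by simpa [res_inc] using hp⟩
  have hXV : ∀ j : Fin N, n ≤ (j : ℕ) → ∀ g ∈ formSpace N (m + 1), X j * g ∈ V := by
    intro j hj g hg
    refine ⟨mul_mem_form (X_mem_form j) hg (by omega), ?_⟩
    simp [res_X_ge j hj]
  have hVbpf : IsBPF N V := by
    intro x hx
    have h1 : (fun i => x (Fin.castLE hN i)) = 0 := by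
      apply hbpf
      intro p hp
      have := hx _ (hincV p hp)
      rw [incHom, eval_rename] at this
      exact this
    funext j
    by_cases hj : (j : ℕ) < n
    · exact congrFun h1 ⟨j, hj⟩
    · have := hx _ (hXV j (not_lt.1 hj) (X j ^ (m + 1)) (isHomogeneous_X_pow j (m + 1)))
      simpa using this
  refine ⟨V, hVle, hVbpf, hVcod, ?_⟩
  have hkey : formSpace N (m + 1 + (m + 2)) ≤ formSpace N (m + 1) * V := by
    refine key_prop V hVle hVbpf ?_
    unfold vcodim at hVcod
    omega
  have hsq : V * V = formSpace N (2 * (m + 2)) ⊓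
      Submodule.comap (resHom n N).toLinearMap (U * U) := by
    apply le_antisymm
    · rw [Submodule.mul_le]
      intro f hf g hg
      refine ⟨mul_mem_form hf.1 hg.1 (by omega), ?_⟩
      have hf2 : resHom n N f ∈ U := hf.2
      have hg2 : resHom n N g ∈ U := hg.2
      simpa using Submodule.mul_mem_mul hf2 hg2
    · rintro f ⟨hf, hfU⟩
      have h1 : incHom hN (resHom n N f) ∈ V * V := by
        have : U * U ≤ Submodule.comap (incHom hN).toLinearMap (V * V) := by
          rw [Submodule.mul_le]
          intro p hp q hq
          simpa using Submodule.mul_mem_mul (hincV p hp) (hincV q hq)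
        exact this hfU
      have h2 : f - incHom hN (resHom n N f) ∈ V * V := by
        have hf' : f ∈ formSpace N (m + 1 + (m + 2) + 1) := by
          rwa [show m + 1 + (m + 2) + 1 = 2 * (m + 2) by omega]
        refine sub_inc_res hN _ f hf' _ ?_
        intro j hj g hg
        have : formSpace N (m + 1) * V ≤
            Submodule.comap (LinearMap.mulLeft ℂ (X j)) (V * V) := by
          rw [Submodule.mul_le]
          intro a ha v hv
          have := Submodule.mul_mem_mul (hXV j hj a ha) hv
          simpa [mul_assoc] using this
        exact this (hkey hg)
      simpa using Submodule.add_mem _ h2 h1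
  rw [hsq, vcodim_pull hN _ (U * U), hs]
  rw [Submodule.mul_le]
  intro p hp q hq
  exact mul_mem_form (hU hp) (hU hq) (by omega)
end

section
/- Let W ⊆ A_d be a linear subspace of dimension k with n ≥ 3k + 1, and suppose W contains no d-th power of a nonzero linear form (L^d ∉ W for all nonzero L ∈ A₁). Then for a generic linear form l ∈ A₁, the image W̄ of W in A_d/(l·A_{d−1}) contains no d-th power of a nonzero linear form of A/⟨l⟩; equivalently, for every L ∈ A₁ not proportional to l, L^d ∉ W + l·A_{d−1}. -/
open MvPolynomial Module

lemma der_basis {ι F : Type*} [Field F] [Algebra ℂ F] (t : ι → F)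
    (ht : IsTranscendenceBasis ℂ t) (u : ι → F) :
    ∃ D : Derivation ℂ F F, ∀ i, D (t i) = u i := by
  classical
  let algA : Algebra (MvPolynomial ι ℂ) F := (aeval t).toRingHom.toAlgebra
  have hA : ∀ p : MvPolynomial ι ℂ, algebraMap (MvPolynomial ι ℂ) F p = aeval t p := fun _ => rfl
  have hinj : Function.Injective (algebraMap (MvPolynomial ι ℂ) F) := ht.1
  have : FaithfulSMul (MvPolynomial ι ℂ) F := (faithfulSMul_iff_algebraMap_injective _ _).2 hinj
  have : IsScalarTower ℂ (MvPolynomial ι ℂ) F := IsScalarTower.of_algebraMap_eq (fun x => by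
    rw [hA]; simp)
  let := FractionRing.liftAlgebra (MvPolynomial ι ℂ) F
  have : IsScalarTower (MvPolynomial ι ℂ) (FractionRing (MvPolynomial ι ℂ)) F :=
    FractionRing.isScalarTower_liftAlgebra _ _
  have : Algebra.IsAlgebraic (MvPolynomial ι ℂ) F := by
    have := ht.isAlgebraic
    constructor
    intro x
    have hx := this.1 x
    obtain ⟨p, hp0, hp⟩ := hx
    let e := ht.1.aevalEquiv
    refine ⟨p.map (e.symm : _ →+* MvPolynomial ι ℂ), ?_, ?_⟩
    · rwa [Ne, Polynomial.map_eq_zero_iff]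
      exact e.symm.injective
    · rw [Polynomial.aeval_def, Polynomial.eval₂_map, ← hp, Polynomial.aeval_def]
      congr 1
      ext y
      simp only [RingHom.comp_apply, hA, RingHom.coe_coe]
      have := ht.1.algebraMap_aevalEquiv (e.symm y)
      rw [← this]; simp [e]
  have : Algebra.IsAlgebraic (FractionRing (MvPolynomial ι ℂ)) F :=
    (IsFractionRing.comap_isAlgebraic_iff (A := MvPolynomial ι ℂ) (K := FractionRing (MvPolynomial ι ℂ)) (C := F)).1 inferInstance
  have : CharZero (FractionRing (MvPolynomial ι ℂ)) := inferInstance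
  have : Algebra.IsSeparable (FractionRing (MvPolynomial ι ℂ)) F := inferInstance
  have : Algebra.FormallyEtale (FractionRing (MvPolynomial ι ℂ)) F := Algebra.FormallyEtale.of_isSeparable _ F
  have : Algebra.FormallySmooth (MvPolynomial ι ℂ) (FractionRing (MvPolynomial ι ℂ)) :=
    Algebra.FormallySmooth.of_isLocalization (nonZeroDivisors (MvPolynomial ι ℂ))
  have : Algebra.FormallySmooth (MvPolynomial ι ℂ) F :=
    Algebra.FormallySmooth.comp _ (FractionRing (MvPolynomial ι ℂ)) F
  let f : MvPolynomial ι ℂ →ₐ[ℂ] TrivSqZeroExt F F :=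
    aeval (fun i => (TrivSqZeroExt.inl (t i) + TrivSqZeroExt.inr (u i) : TrivSqZeroExt F F))
  let algE : Algebra (MvPolynomial ι ℂ) (TrivSqZeroExt F F) := f.toRingHom.toAlgebra
  have hE : ∀ p : MvPolynomial ι ℂ, algebraMap (MvPolynomial ι ℂ) (TrivSqZeroExt F F) p = f p :=
    fun _ => rfl
  have hfst : ∀ p, (TrivSqZeroExt.fstHom ℂ F F) (f p) = aeval t p := by
    intro p
    rw [← AlgHom.comp_apply]
    congr 1
    ext i
    simp [f]
  let g : TrivSqZeroExt F F →ₐ[MvPolynomial ι ℂ] F :=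
    { (TrivSqZeroExt.fstHom ℂ F F : TrivSqZeroExt F F →+* F) with
      commutes' := fun p => hfst p }
  have hg : ∀ x, g x = x.fst := fun _ => rfl
  have hgs : Function.Surjective g := fun x => ⟨TrivSqZeroExt.inl x, by simp [hg]⟩
  have hnil : IsNilpotent (RingHom.ker (g : TrivSqZeroExt F F →+* F)) := by
    refine ⟨2, ?_⟩
    rw [Submodule.pow_succ, Submodule.pow_one, Ideal.zero_eq_bot, eq_bot_iff, Ideal.mul_le]
    intro r hr s hs
    have hr' : r.fst = 0 := hr
    have hs' : s.fst = 0 := hs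
    rw [Ideal.mem_bot]
    ext <;> simp [hr', hs']
  let h := Algebra.FormallySmooth.liftOfSurjective (AlgHom.id (MvPolynomial ι ℂ) F) g hgs hnil
  have hh : ∀ x, (h x).fst = x := fun x =>
    Algebra.FormallySmooth.liftOfSurjective_apply (AlgHom.id (MvPolynomial ι ℂ) F) g hgs hnil x
  have hc : ∀ p, h (aeval t p) = f p := fun p => by rw [← hE, ← h.commutes, hA]
  have hcc : ∀ c : ℂ, h (algebraMap ℂ F c) = algebraMap ℂ _ c := fun c => by
    have := hc (C c); simp
  have hmul : ∀ x y, (h (x * y)).snd = x * (h y).snd + y * (h x).snd := by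
    intro x y
    rw [map_mul, TrivSqZeroExt.snd_mul, hh, hh]; simp [mul_comm]
  refine ⟨Derivation.mk' { toFun := fun x => (h x).snd, map_add' := ?_, map_smul' := ?_ } ?_, ?_⟩
  · intro x y; simp
  · intro c x
    rw [Algebra.smul_def, hmul, hcc]
    simp [Algebra.smul_def]
    right
    rw [TrivSqZeroExt.algebraMap_eq_inl' (S := ℂ) (R := F) (M := F) c]
    simp
  · intro x y
    exact hmul x y
  · intro i
    have := hc (X i)
    rw [aeval_X] at this
    change (h (t i)).snd = _
    rw [this]; simp [f]

lemma der_exists {ι F : Type*} [Field F] [Algebra ℂ F] (t : ι → F)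
    (ht : AlgebraicIndependent ℂ t) (u : ι → F) :
    ∃ D : Derivation ℂ F F, ∀ i, D (t i) = u i := by
  classical
  obtain ⟨s, hs, hb⟩ := exists_isTranscendenceBasis_superset (AlgebraicIndependent.coe_range ht)
  have hti := ht.injective
  obtain ⟨D, hD⟩ := der_basis _ hb (fun y => Function.extend t u 0 y.1)
  refine ⟨D, fun i => ?_⟩
  have := hD ⟨t i, hs ⟨i, rfl⟩⟩
  rw [hti.extend_apply] at this
  exact this
lemma der_good {n k : ℕ} {F : Type*} [Field F] [Algebra ℂ F] (t : Fin n → F)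
    (ht : AlgebraicIndependent ℂ t) (a : Fin k → F) (S : Submodule F (Fin n → F))
    (hS : finrank F S + k < n) :
    ∃ D : Derivation ℂ F F, (∀ j, D (a j) = 0) ∧ (fun i => D (t i)) ∉ S := by
  classical
  choose E hE using fun i : Fin n => der_exists t ht (Pi.single i 1)
  let T : (Fin n → F) →ₗ[F] (Fin k → F) :=
    LinearMap.pi fun j => ∑ i, (E i (a j)) • LinearMap.proj i
  have hT : ∀ u j, T u j = ∑ i, u i * E i (a j) := by
    intro u j; simp [T, mul_comm]
  by_contra hcon
  push Not at hcon
  have hle : LinearMap.ker T ≤ S := by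
    intro u hu
    have hsum : ∀ y, (∑ i, u i • E i) y = ∑ i, u i * E i y := by
      intro y
      have := congrFun (map_sum (Derivation.coeFnAddMonoidHom (R := ℂ) (A := F) (M := F))
        (fun i => u i • E i) Finset.univ) y
      refine this.trans ?_
      rw [Finset.sum_apply]
      rfl
    have h := hcon (∑ i, u i • E i) (fun j => by
      have := congrFun (LinearMap.mem_ker.1 hu) j
      rw [hT] at this
      rw [hsum]; exact this)
    convert h using 1
    funext i
    simp [hsum, hE, Pi.single_apply]
  have h1 := Submodule.finrank_mono hle
  have h2 := LinearMap.finrank_range_add_finrank_ker T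
  have h3 := Submodule.finrank_le (LinearMap.range T)
  simp at h2 h3
  omega

lemma coeff_der {σ F : Type*} [Field F] [Algebra ℂ F] (D : Derivation ℂ F F) :
    ∃ δ : MvPolynomial σ F → MvPolynomial σ F, ∀ p m, coeff m (δ p) = D (coeff m p) := by
  classical
  refine ⟨fun p => ∑ m ∈ p.support, monomial m (D (coeff m p)), fun p m => ?_⟩
  rw [coeff_sum]
  simp only [coeff_monomial, Finset.sum_ite_eq']
  split_ifs with h
  · rfl
  · rw [notMem_support_iff.1 h, map_zero]

noncomputable def lf {n : ℕ} {F : Type*} [CommRing F] (c : Fin n → F) : MvPolynomial (Fin n) F :=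
  ∑ i, C (c i) * X i

lemma eval_lf {n : ℕ} {F : Type*} [CommRing F] (c x : Fin n → F) :
    eval x (lf c) = ∑ i, c i * x i := by simp [lf]

lemma lf_add {n : ℕ} {F : Type*} [CommRing F] (c e : Fin n → F) :
    lf (c + e) = lf c + lf e := by simp [lf, add_mul, Finset.sum_add_distrib]

lemma lf_smul {n : ℕ} {F : Type*} [CommRing F] (a : F) (c : Fin n → F) :
    lf (a • c) = C a * lf c := by simp [lf, Finset.mul_sum, mul_assoc]

lemma lf_map {n : ℕ} {F E : Type*} [CommRing F] [CommRing E] (f : F →+* E) (c : Fin n → F) :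
    map f (lf c) = lf (fun i => f (c i)) := by simp [lf]

lemma lf_hom {n : ℕ} {F : Type*} [CommRing F] (c : Fin n → F) : (lf c).IsHomogeneous 1 := by
  refine IsHomogeneous.sum _ _ _ fun i _ => ?_
  simpa using (isHomogeneous_C (Fin n) (c i)).mul (isHomogeneous_X F i)

lemma coeff_lf {n : ℕ} {F : Type*} [CommRing F] (c : Fin n → F) (i : Fin n) :
    coeff (Finsupp.single i 1) (lf c) = c i := by
  classical
  simp [lf, coeff_sum, coeff_C_mul, coeff_X, Finsupp.single_left_inj]

lemma lf_inj {n : ℕ} {F : Type*} [CommRing F] {c e : Fin n → F} (h : lf c = lf e) : c = e := by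
  funext i; rw [← coeff_lf c, h, coeff_lf]

/-- every form of degree one is `lf c` -/
lemma lf_of_hom {n : ℕ} {F : Type*} [CommRing F] (p : MvPolynomial (Fin n) F)
    (hp : p.IsHomogeneous 1) : ∃ c, p = lf c := by
  classical
  refine ⟨fun i => coeff (Finsupp.single i 1) p, ?_⟩
  ext m
  by_cases hm : m.degree = 1
  · obtain ⟨i, rfl⟩ := (Finsupp.sum_eq_one_iff m).1 hm
    rw [coeff_lf]
  · rw [hp.coeff_eq_zero hm, (lf_hom _).coeff_eq_zero hm]

lemma lf_zero {n : ℕ} {F : Type*} [CommRing F] : lf (0 : Fin n → F) = 0 := by simp [lf]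

lemma lf_prime {n : ℕ} {F : Type*} [Field F] {c : Fin n → F} (hc : c ≠ 0) : Prime (lf c) := by
  have h0 : lf c ≠ 0 := fun h => hc (lf_inj (h.trans lf_zero.symm))
  apply Irreducible.prime
  apply irreducible_of_totalDegree_eq_one ((lf_hom c).totalDegree h0)
  intro x hx
  rw [isUnit_iff_ne_zero]
  rintro rfl
  apply h0
  ext m
  simpa using hx m

lemma lf_dvd {n : ℕ} {F : Type*} [Field F] {c e : Fin n → F} (h : lf c ∣ lf e) :
    ∃ a : F, e = a • c := by
  by_cases he : e = 0
  · exact ⟨0, by simp [he]⟩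
  obtain ⟨r, hr⟩ := h
  have h0 : lf e ≠ 0 := fun h => he (lf_inj (h.trans lf_zero.symm))
  have hc0 : lf c ≠ 0 := by rintro h; simp [h] at hr; exact h0 hr
  have hr0 : r ≠ 0 := by rintro rfl; simp at hr; exact h0 hr
  have h1 := (lf_hom e).totalDegree h0
  rw [hr, totalDegree_mul_of_isDomain hc0 hr0, (lf_hom c).totalDegree hc0] at h1
  obtain ⟨a, rfl⟩ : ∃ a, r = C a := ⟨_, (totalDegree_eq_zero_iff_eq_C (p := r)).mp (by omega)⟩
  exact ⟨a, lf_inj (by rw [hr, lf_smul, mul_comm])⟩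

/-- duality -/
lemma dual_pt {n : ℕ} {F : Type*} [Field F] {c e v : Fin n → F}
    (h : ∀ x : Fin n → F, ∑ i, c i * x i = 0 → ∑ i, e i * x i = 0 → ∑ i, v i * x i = 0) :
    ∃ a b : F, v = a • c + b • e := by
  classical
  let φ : (Fin n → F) → (Fin n → F) →ₗ[F] F := fun c => ∑ i, c i • LinearMap.proj i
  have hφ : ∀ c x, φ c x = ∑ i, c i * x i := by intro c x; simp [φ]
  have := mem_span_of_iInf_ker_le_ker (L := ![φ c, φ e]) (K := φ v) (by
    intro x hx
    simp only [Submodule.mem_iInf, Fin.forall_fin_two, LinearMap.mem_ker] at hx ⊢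
    simp only [Matrix.cons_val_zero, Matrix.cons_val_one, hφ] at hx
    rw [hφ]; exact h x hx.1 hx.2)
  rw [Submodule.mem_span_range_iff_exists_fun] at this
  obtain ⟨w, hw⟩ := this
  refine ⟨w 0, w 1, ?_⟩
  funext j
  have := LinearMap.congr_fun hw (Pi.single j 1)
  simp [Fin.sum_univ_two, hφ, Pi.single_apply] at this
  simp [this]

lemma nullst {σ F : Type*} [Finite σ] [Field F] [Algebra ℂ F] (z : σ → F) :
    ∃ z' : σ → ℂ, ∀ p : MvPolynomial σ ℂ, aeval z p = 0 → aeval z' p = 0 := by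
  have hne : RingHom.ker (aeval z : MvPolynomial σ ℂ →ₐ[ℂ] F) ≠ ⊤ := RingHom.ker_ne_top _
  obtain ⟨M, hM, hle⟩ := Ideal.exists_le_maximal _ hne
  obtain ⟨x, hx⟩ := isMaximal_iff_eq_vanishingIdeal_singleton.1 hM
  refine ⟨x, fun p hp => ?_⟩
  have : p ∈ M := hle hp
  rw [hx, mem_vanishingIdeal_singleton_iff] at this
  simpa using this

lemma descend {n k d : ℕ} {F : Type*} [Field F] [Algebra ℂ F]
    (b : Fin k → MvPolynomial (Fin n) ℂ) (a : Fin k → F) (L : Fin n → F) (hL : L ≠ 0)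
    (h : ∑ j, C (a j) * map (algebraMap ℂ F) (b j) = lf L ^ d) :
    ∃ (a' : Fin k → ℂ) (L' : Fin n → ℂ), L' ≠ 0 ∧ ∑ j, C (a' j) * b j = lf L' ^ d := by
  obtain ⟨i₀, hi₀⟩ := Function.ne_iff.1 hL
  let z : Fin k ⊕ Fin n ⊕ Unit → F := Sum.elim a (Sum.elim L fun _ => (L i₀)⁻¹)
  obtain ⟨z', hz'⟩ := nullst z
  let G : MvPolynomial (Fin n) (MvPolynomial (Fin k ⊕ Fin n ⊕ Unit) ℂ) :=
    ∑ j, C (X (Sum.inl j)) * map C (b j) - lf (fun i => X (Sum.inr (Sum.inl i))) ^ d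
  have hG : map (aeval z : _ →ₐ[ℂ] F).toRingHom G = 0 := by
    have hc : ((aeval z : MvPolynomial (Fin k ⊕ Fin n ⊕ Unit) ℂ →ₐ[ℂ] F).toRingHom).comp C = algebraMap ℂ F := by
      ext; simp
    simp only [G, map_sub, map_sum, map_mul, map_pow, lf_map, map_C, map_map, hc, sub_eq_zero]
    convert h using 2
    · simp [z]
    · congr 1; simp [z]
  have hG' : map (aeval z' : _ →ₐ[ℂ] ℂ).toRingHom G = 0 := by
    ext m
    have := congrArg (coeff m) hG
    rw [coeff_map] at this ⊢
    exact hz' _ this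
  have hc : ((aeval z' : MvPolynomial (Fin k ⊕ Fin n ⊕ Unit) ℂ →ₐ[ℂ] ℂ).toRingHom).comp C = RingHom.id ℂ := by
      ext; simp
  simp only [G, map_sub, map_sum, map_mul, map_pow, lf_map, map_C, map_map, hc, sub_eq_zero, map_id] at hG'
  refine ⟨fun j => z' (Sum.inl j), fun i => z' (Sum.inr (Sum.inl i)), ?_, ?_⟩
  · intro h0
    have := hz' (X (Sum.inr (Sum.inl i₀)) * X (Sum.inr (Sum.inr ())) - 1) (by
      simp [z]; rw [mul_inv_cancel₀ hi₀, sub_self])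
    have h1 := congrFun h0 i₀
    simp at h1
    simp [h1] at this
  · simpa using hG'

lemma main_alg {n d : ℕ} {F : Type*} [Field F] [Algebra ℂ F] [CharZero F] (hd : 2 ≤ d)
    (D : Derivation ℂ F F) (t L : Fin n → F) (w : MvPolynomial (Fin n) F)
    (hw : w.IsHomogeneous d) (hDw : ∀ m, D (coeff m w) = 0)
    (hL : ∀ a : F, L ≠ a • t)
    (hu : ∀ a b : F, (fun i => D (t i)) ≠ a • t + b • L)
    (hdvd : lf t ∣ w - lf L ^ d) :
    ∃ L' : Fin n → F, L' ≠ 0 ∧ w = lf L' ^ d := by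
  obtain ⟨δ, hδ⟩ := coeff_der (σ := Fin n) D
  have δadd : ∀ p q, δ (p + q) = δ p + δ q := by
    intro p q; ext m; simp [hδ]
  have δmul : ∀ p q, δ (p * q) = p * δ q + q * δ p := by
    intro p q
    classical
    ext m
    rw [hδ, coeff_mul, coeff_add, mul_comm q, coeff_mul, coeff_mul, map_sum,
      ← Finset.sum_add_distrib]
    refine Finset.sum_congr rfl fun x _ => ?_
    rw [hδ, hδ, Derivation.leibniz, smul_eq_mul, smul_eq_mul, mul_comm (coeff x.2 q)]
  have δone : δ 1 = 0 := by
    classical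
    ext m; rw [hδ, coeff_one]; split_ifs <;> simp
  have δpow : ∀ p (e : ℕ), δ (p ^ (e + 1)) = (e + 1 : ℕ) * (p ^ e * δ p) := by
    intro p e
    induction e with
    | zero => simp
    | succ e ih => rw [pow_succ, δmul, ih]; push_cast; ring
  have δlf : ∀ c : Fin n → F, δ (lf c) = lf (fun i => D (c i)) := by
    intro c
    ext m
    rw [hδ]
    by_cases hm : m.degree = 1
    · obtain ⟨i, rfl⟩ := (Finsupp.sum_eq_one_iff m).1 hm
      rw [coeff_lf, coeff_lf]
    · rw [(lf_hom _).coeff_eq_zero hm, (lf_hom _).coeff_eq_zero hm, map_zero]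
  have δw : δ w = 0 := by ext m; simp [hδ, hDw]
  set u : Fin n → F := fun i => D (t i) with hudef
  set l := lf t with hl
  set v := lf u with hv
  have δl : δ l = v := δlf t
  have ht0 : t ≠ 0 := by
    rintro rfl
    exact hu 0 0 (by funext i; simp [hudef])
  have hlp : Prime l := lf_prime ht0
  have hlv : ¬ l ∣ v := by
    intro h
    obtain ⟨a, ha⟩ := lf_dvd h
    exact hu a 0 (by rw [ha]; simp)
  obtain ⟨e, rfl⟩ : ∃ e, d = e + 2 := ⟨d - 2, by omega⟩
  have key : ∀ j : ℕ, ∃ c : F, l ^ (j + 1) ∣ w - lf (L + c • t) ^ (e + 2) := by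
    intro j
    induction j with
    | zero => exact ⟨0, by simpa using hdvd⟩
    | succ j ih =>
      obtain ⟨c, q, hq⟩ := ih
      set M : Fin n → F := L + c • t with hM
      -- a point with l = v = 0, M ≠ 0
      have hpt : ∃ x, eval x l = 0 ∧ eval x v = 0 ∧ eval x (lf M) ≠ 0 := by
        by_contra hcon
        push Not at hcon
        obtain ⟨a, b, hab⟩ := dual_pt (c := t) (e := u) (v := M) (fun x h1 h2 => by
          have := hcon x (by rw [hl, eval_lf]; exact h1) (by rw [hv, eval_lf]; exact h2)
          rwa [eval_lf] at this)
        by_cases hb : b = 0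
        · apply hL (a - c)
          have : L = M - c • t := by rw [hM]; simp
          rw [this, hab, hb, sub_smul]; simp
        · apply hu (b⁻¹ * (c - a)) b⁻¹
          have : u = b⁻¹ • (M - a • t) := by
            rw [hab]; simp [smul_smul, inv_mul_cancel₀ hb]
          rw [this, hM]
          funext i
          simp
          ring
      obtain ⟨x, hxl, hxv, hxM⟩ := hpt
      have hlM : ¬ l ∣ lf M := by
        rintro ⟨r, hr⟩
        apply hxM; rw [hr]; simp [hxl]
      set N : Fin n → F := fun i => D (M i) with hN
      have hw' : w = lf M ^ (e + 2) + l ^ (j + 1) * q := by rw [← hq]; ring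
      have heq : ((e + 2 : ℕ) : MvPolynomial (Fin n) F) * (lf M ^ (e + 1) * lf N)
          + (l ^ (j + 1) * δ q + q * (((j + 1 : ℕ) : MvPolynomial (Fin n) F) * (l ^ j * v))) = 0 := by
        rw [← δlf M, ← δl, ← δpow, ← δpow, ← δmul, ← δadd, ← hw', δw]
      have hne : ((e + 2 : ℕ) : F) ≠ 0 := by exact_mod_cast (by omega : e + 2 ≠ 0)
      have hcast : ∀ m : ℕ, ((m : ℕ) : MvPolynomial (Fin n) F) = C (m : F) := fun m => by simp
      have hcancel : ∀ m : ℕ, m ≠ 0 → ∀ p, l ∣ ((m : ℕ) : MvPolynomial (Fin n) F) * p → l ∣ p := by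
        intro m hm p hp
        rcases hlp.dvd_or_dvd hp with h | h
        · exfalso
          apply hlp.not_isUnit
          refine isUnit_of_dvd_unit h ?_
          rw [hcast]
          exact (isUnit_iff_ne_zero.2 (by exact_mod_cast hm : (m : F) ≠ 0)).map C
        · exact h
      rcases Nat.eq_zero_or_pos j with rfl | hj
      · -- first step
        obtain ⟨a, b, hab⟩ := dual_pt (c := t) (e := u) (v := N) (fun y h1 h2 => by
          -- product of the linear forms M and N vanishes on the subspace
          rw [← eval_lf] at h1 h2 ⊢
          have hprod : ∀ y, eval y (lf t) = 0 → eval y (lf u) = 0 →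
              eval y (lf M) = 0 ∨ eval y (lf N) = 0 := by
            intro y h1 h2
            have := congrArg (eval y) heq
            simp [hl, hv, h1, h2] at this
            rcases this with h | h | h
            · exfalso; exact hne (by push_cast; exact h)
            · exact Or.inl h
            · exact Or.inr h
          by_contra hNy
          have hMy := (hprod y h1 h2).resolve_right hNy
          have hNx := (hprod x hxl hxv).resolve_left hxM
          have hadd : ∀ c : Fin n → F, eval (x + y) (lf c) = eval x (lf c) + eval y (lf c) := by
            intro c; simp [eval_lf, mul_add, Finset.sum_add_distrib]
          rcases hprod (x + y) (by rw [hadd, h1, ← hl, hxl, add_zero])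
            (by rw [hadd, h2, ← hv, hxv, add_zero]) with h | h
          · rw [hadd, hMy, add_zero] at h; exact hxM h
          · rw [hadd, hNx, zero_add] at h; exact hNy h)
        have hNlf : lf N = C a * l + C b * v := by rw [hab, lf_add, lf_smul, lf_smul]
        rw [hNlf] at heq
        have h1 : l ∣ v * (((e + 2 : ℕ) : MvPolynomial (Fin n) F) * C b * lf M ^ (e + 1) + q) := by
          refine ⟨-(((e + 2 : ℕ) : MvPolynomial (Fin n) F) * (lf M ^ (e + 1) * C a) + δ q), ?_⟩
          push_cast at heq ⊢
          linear_combination heq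
        obtain ⟨r, hr⟩ := (hlp.dvd_or_dvd h1).resolve_left hlv
        refine ⟨c - b, ?_⟩
        have hMb : lf (L + (c - b) • t) = lf M - C b * l := by
          have : L + (c - b) • t = M + (-b) • t := by rw [hM, sub_smul, neg_smul]; abel
          rw [this, lf_add, lf_smul]; simp [hl]; ring
        rw [hMb, hw']
        -- binomial expansion modulo l ^ 2
        have hbin : ∃ s, (lf M - C b * l) ^ (e + 2) = lf M ^ (e + 2)
            - ((e + 2 : ℕ) : MvPolynomial (Fin n) F) * lf M ^ (e + 1) * (C b * l) + l ^ 2 * s := by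
          obtain ⟨s, hs⟩ := Polynomial.powAddExpansion (lf M) (-(C b * l)) (e + 2)
          refine ⟨s * C b ^ 2, ?_⟩
          rw [sub_eq_add_neg, hs]
          simp only [Nat.add_succ_sub_one]
          ring
        obtain ⟨s, hs⟩ := hbin
        rw [hs]
        refine ⟨r - s, ?_⟩
        linear_combination l * hr
      · obtain ⟨i, rfl⟩ : ∃ i, j = i + 1 := ⟨j - 1, by omega⟩
        have h1 : l ∣ ((e + 2 : ℕ) : MvPolynomial (Fin n) F) * (lf M ^ (e + 1) * lf N) :=
          ⟨-(l ^ (i + 1) * δ q + q * (((i + 1 + 1 : ℕ) : MvPolynomial (Fin n) F) * (l ^ i * v))), by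
            linear_combination heq⟩
        have h2 := hcancel _ (by omega) _ h1
        have h3 : l ∣ lf N :=
          (hlp.dvd_or_dvd h2).resolve_left fun h => hlM (hlp.dvd_of_dvd_pow h)
        obtain ⟨a, ha⟩ := lf_dvd h3
        have hNl : lf N = C a * l := by rw [ha, lf_smul]
        rw [hNl] at heq
        have heq2 : ((e + 2 : ℕ) : MvPolynomial (Fin n) F) * (lf M ^ (e + 1) * C a)
          + (l ^ (i + 1) * δ q + q * (((i + 1 + 1 : ℕ) : MvPolynomial (Fin n) F) * (l ^ i * v))) = 0 := by
          apply mul_left_cancel₀ hlp.ne_zero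
          linear_combination heq
        have ha0 : a = 0 := by
          have := congrArg (eval x) heq2
          simp [hxl, hxv, hxM] at this
          rcases this with h | h
          · exfalso; exact hne (by push_cast; exact h)
          · exact h
        have heq3 : l * δ q + q * (((i + 1 + 1 : ℕ) : MvPolynomial (Fin n) F) * v) = 0 := by
          apply mul_left_cancel₀ (pow_ne_zero i hlp.ne_zero)
          rw [ha0] at heq2
          simp only [map_zero, mul_zero, zero_add] at heq2
          linear_combination heq2
        have h4 : l ∣ ((i + 1 + 1 : ℕ) : MvPolynomial (Fin n) F) * (v * q) :=
          ⟨-δ q, by linear_combination heq3⟩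
        obtain ⟨r, hr⟩ := (hlp.dvd_or_dvd (hcancel _ (by omega) _ h4)).resolve_left hlv
        refine ⟨c, r, ?_⟩
        rw [hq, hr]; ring
  obtain ⟨c, r, hr⟩ := key (e + 2)
  refine ⟨L + c • t, ?_, ?_⟩
  · intro h
    apply hL (-c)
    rw [neg_smul]
    exact eq_neg_of_add_eq_zero_left h
  · have hh : (w - lf (L + c • t) ^ (e + 2)).IsHomogeneous (e + 2) := by
      apply hw.sub
      simpa using (lf_hom (L + c • t)).pow (e + 2)
    by_contra hne
    have hne' : w - lf (L + c • t) ^ (e + 2) ≠ 0 := sub_ne_zero.2 hne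
    have hdeg := hh.totalDegree hne'
    have hr0 : r ≠ 0 := by rintro rfl; simp at hr; exact hne' hr
    have hp0 : l ^ (e + 2 + 1) ≠ 0 := pow_ne_zero _ hlp.ne_zero
    have hph : (l ^ (e + 2 + 1)).IsHomogeneous (e + 2 + 1) := by
      simpa using (lf_hom t).pow (e + 2 + 1)
    rw [hr, totalDegree_mul_of_isDomain hp0 hr0, hph.totalDegree hp0] at hdeg
    omega

def badPt {n k : ℕ} (d : ℕ) (b : Fin k → MvPolynomial (Fin n) ℂ) (i j : Fin n)
    (c : Fin n → ℂ) : Prop :=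
  ∃ (a : Fin k → ℂ) (L : Fin n → ℂ) (q : MvPolynomial (Fin n) ℂ), q.IsHomogeneous (d - 1) ∧
    lf L ^ d = ∑ j, C (a j) * b j + lf c * q ∧ L i * c j - L j * c i ≠ 0

lemma generic {n d k : ℕ} (hd : 2 ≤ d) (hn : 3 * k + 1 ≤ n)
    (b : Fin k → MvPolynomial (Fin n) ℂ) (hb : ∀ j, (b j).IsHomogeneous d)
    (hpow : ∀ (a : Fin k → ℂ) (L : Fin n → ℂ), L ≠ 0 → ∑ j, C (a j) * b j ≠ lf L ^ d)
    (i₁ i₂ : Fin n) :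
    ∃ P : MvPolynomial (Fin n) ℂ, P ≠ 0 ∧ ∀ c, eval c P ≠ 0 → ¬ badPt d b i₁ i₂ c := by
  classical
  by_contra hcon
  push Not at hcon
  let B := {c : Fin n → ℂ // badPt d b i₁ i₂ c}
  have hB : ∀ c : B, badPt d b i₁ i₂ c.1 := fun c => c.2
  choose a L q hqh hq hmin using hB
  let R := B → ℂ
  let T : Fin n → R := fun i c => c.1 i
  have hT : ∀ (P : MvPolynomial (Fin n) ℂ) (c : B), (aeval T P) c = eval c.1 P := by
    intro P c
    have : ((Pi.evalAlgHom ℂ (fun _ : B => ℂ) c).comp (aeval T)) P = aeval c.1 P := by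
      congr 1
      ext i
      simp [T]
    simpa using this
  let S : Submonoid R := (nonZeroDivisors (MvPolynomial (Fin n) ℂ)).map (aeval T : _ →ₐ[ℂ] R)
  have hdisj : Disjoint ((⊥ : Ideal R) : Set R) S := by
    rw [Set.disjoint_left]
    rintro x hx ⟨P, hP, rfl⟩
    obtain ⟨c, hc, hbad⟩ := hcon P (nonZeroDivisors.ne_zero hP)
    apply hc
    rw [← hT P ⟨c, hbad⟩]
    exact congrFun hx _
  obtain ⟨p, hp, -, hpS⟩ := Ideal.exists_le_prime_disjoint ⊥ S hdisj
  let F := FractionRing (R ⧸ p)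
  let π : R →ₐ[ℂ] F := (IsScalarTower.toAlgHom ℂ (R ⧸ p) F).comp (Ideal.Quotient.mkₐ ℂ p)
  have hπ : ∀ r, π r = 0 → r ∈ p := by
    intro r hr
    rw [← Ideal.Quotient.eq_zero_iff_mem]
    apply IsFractionRing.injective (R ⧸ p) F
    rw [map_zero]
    exact hr
  have hcz : CharZero F := charZero_of_injective_algebraMap (algebraMap ℂ F).injective
  let t : Fin n → F := fun i => π (T i)
  have ht : AlgebraicIndependent ℂ t := by
    rw [algebraicIndependent_iff]
    intro P hP
    by_contra hP0
    have h1 : aeval t P = π (aeval T P) := by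
      rw [← AlgHom.comp_apply]
      congr 1
      ext i
      simp [t]
    rw [h1] at hP
    exact Set.disjoint_left.1 hpS (hπ _ hP)
      ⟨P, mem_nonZeroDivisors_of_ne_zero hP0, rfl⟩
  -- the data over R
  let aR : Fin k → R := fun j c => a c j
  let LR : Fin n → R := fun i c => L c i
  let qR : MvPolynomial (Fin n) R :=
    ∑ m ∈ (Finsupp.finite_of_degree_eq (σ := Fin n) (d - 1)).toFinset,
      monomial m (fun c : B => coeff m (q c))
  have hqR : ∀ c : B, map (Pi.evalRingHom (fun _ : B => ℂ) c) qR = q c := by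
    intro c
    ext m
    simp only [qR, map_sum, map_monomial, coeff_sum, coeff_monomial, Finset.sum_ite_eq']
    split_ifs with h
    · rfl
    · symm
      apply (hqh c).coeff_eq_zero
      simpa using h
  have hR : lf LR ^ d = ∑ j, C (aR j) * map (algebraMap ℂ R) (b j) + lf T * qR := by
    have hext : ∀ f g : MvPolynomial (Fin n) R,
        (∀ c : B, map (Pi.evalRingHom (fun _ : B => ℂ) c) f
          = map (Pi.evalRingHom (fun _ : B => ℂ) c) g) → f = g := by
      intro f g h
      ext m c
      have := congrArg (coeff m) (h c)
      rw [coeff_map, coeff_map] at this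
      exact this
    apply hext
    intro c
    have hid : (Pi.evalRingHom (fun _ : B => ℂ) c).comp (algebraMap ℂ R) = RingHom.id ℂ := by
      ext; rfl
    simp only [map_add, map_mul, map_pow, map_sum, lf_map, map_C, map_map, hid, map_id, hqR]
    exact hq c
  let aF : Fin k → F := fun j => π (aR j)
  let LF : Fin n → F := fun i => π (LR i)
  have hF : lf LF ^ d = ∑ j, C (aF j) * map (algebraMap ℂ F) (b j)
      + lf t * map π.toRingHom qR := by
    have := congrArg (map π.toRingHom) hR
    have hid : π.toRingHom.comp (algebraMap ℂ R) = algebraMap ℂ F := π.comp_algebraMap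
    simp only [map_add, map_mul, map_pow, map_sum, lf_map, map_C, map_map, hid] at this
    exact this
  have hminF : LF i₁ * t i₂ - LF i₂ * t i₁ ≠ 0 := by
    have hu : IsUnit (LR i₁ * T i₂ - LR i₂ * T i₁) := by
      rw [Pi.isUnit_iff]
      intro c
      exact isUnit_iff_ne_zero.2 (hmin c)
    have := (hu.map π).ne_zero
    simpa [LF, t] using this
  have hLt : ∀ s : F, LF ≠ s • t := by
    intro s hs
    apply hminF
    rw [hs]; simp; ring
  set w := ∑ j, C (aF j) * map (algebraMap ℂ F) (b j) with hw
  have hwh : w.IsHomogeneous d := by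
    refine IsHomogeneous.sum _ _ _ fun j _ => ?_
    simpa using (isHomogeneous_C (Fin n) (aF j)).mul ((hb j).map (algebraMap ℂ F))
  have hdvd : lf t ∣ w - lf LF ^ d := ⟨-map π.toRingHom qR, by rw [hF]; ring⟩
  suffices h : ∃ L' : Fin n → F, L' ≠ 0 ∧ w = lf L' ^ d by
    obtain ⟨L', hL', hwL⟩ := h
    obtain ⟨a', L'', h1, h2⟩ := descend b aF L' hL' hwL
    exact hpow a' L'' h1 h2
  rcases Nat.eq_zero_or_pos k with rfl | hk
  · exfalso
    have hw0 : w = 0 := by simp [hw]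
    have ht0 : t ≠ 0 := by
      intro h0
      apply hminF
      simp [h0]
    rw [hw0, zero_sub, dvd_neg] at hdvd
    obtain ⟨s, hs⟩ := lf_dvd ((lf_prime ht0).dvd_of_dvd_pow hdvd)
    exact hLt s hs
  · obtain ⟨D, hDa, hDS⟩ := der_good t ht aF (Submodule.span F {t, LF}) (by
      have := finrank_span_le_card (R := F) ({t, LF} : Set (Fin n → F))
      have h2 : ({t, LF} : Set (Fin n → F)).toFinset.card ≤ 2 := by
        simpa using Finset.card_le_two (a := t) (b := LF)
      omega)
    refine main_alg hd D t LF w hwh ?_ hLt ?_ hdvd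
    · intro m
      simp [hw, coeff_sum, coeff_C_mul, coeff_map, hDa]
    · intro x y hxy
      exact hDS (Submodule.mem_span_pair.2 ⟨x, y, hxy.symm⟩)

theorem stmt19 (n d k : ℕ) (hd : 2 ≤ d) (hn : 3 * k + 1 ≤ n)
    (W : Submodule ℂ (PolyR n)) (hW : W ≤ formSpace n d) (hdim : finrank ℂ W = k)
    (hpow : ∀ L : PolyR n, L ∈ formSpace n 1 → L ≠ 0 → L ^ d ∉ W) :
    ∃ P : MvPolynomial (Fin n) ℂ, P ≠ 0 ∧ ∀ c : Fin n → ℂ, eval c P ≠ 0 →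
      ∀ L : PolyR n, L ∈ formSpace n 1 → L ∉ Submodule.span ℂ {linForm n c} →
        L ^ d ∉ W ⊔ (Submodule.span ℂ {linForm n c} * formSpace n (d - 1)) := by
  classical
  have hlin : ∀ c, linForm n c = lf c := by
    intro c; simp [linForm, lf, smul_eq_C_mul]
  have hle : W ≤ restrictTotalDegree (Fin n) ℂ d := by
    intro p hp
    rw [mem_restrictTotalDegree]
    exact ((mem_homogeneousSubmodule _ _).1 (hW hp)).totalDegree_le
  have hfin : Module.Finite ℂ W := Submodule.finiteDimensional_of_le hle
  let bas := Module.finBasisOfFinrankEq ℂ W hdim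
  let b : Fin k → MvPolynomial (Fin n) ℂ := fun j => (bas j : PolyR n)
  have hbW : ∀ j, b j ∈ W := fun j => (bas j).2
  have hb : ∀ j, (b j).IsHomogeneous d := fun j =>
    (mem_homogeneousSubmodule _ _).1 (hW (hbW j))
  have hpow' : ∀ (a : Fin k → ℂ) (L : Fin n → ℂ), L ≠ 0 →
      ∑ j, C (a j) * b j ≠ lf L ^ d := by
    intro a L hL h
    apply hpow (lf L) ((mem_homogeneousSubmodule _ _).2 (lf_hom L))
      (fun h0 => hL (lf_inj (h0.trans lf_zero.symm)))
    rw [← h]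
    refine W.sum_mem fun j _ => ?_
    rw [← smul_eq_C_mul]
    exact W.smul_mem _ (hbW j)
  choose P hP0 hP using generic hd hn b hb hpow'
  let i₀ : Fin n := ⟨0, by omega⟩
  refine ⟨X i₀ * ∏ i, P i i₀, ?_, ?_⟩
  · exact mul_ne_zero (X_ne_zero _) (Finset.prod_ne_zero_iff.2 fun i _ => hP0 i i₀)
  · intro c hc L hL hLc hmem
    rw [map_mul, map_prod, eval_X] at hc
    have hc0 := left_ne_zero_of_mul hc
    have hcP := Finset.prod_ne_zero_iff.1 (right_ne_zero_of_mul hc)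
    obtain ⟨L₀, rfl⟩ := lf_of_hom L ((mem_homogeneousSubmodule _ _).1 hL)
    rw [hlin] at hLc hmem
    obtain ⟨w, hw, y, hy, hwy⟩ := Submodule.mem_sup.1 hmem
    obtain ⟨q, hq, rfl⟩ := Submodule.mem_span_singleton_mul.1 hy
    apply hLc
    rw [Submodule.mem_span_singleton]
    refine ⟨L₀ i₀ / c i₀, ?_⟩
    rw [smul_eq_C_mul, ← lf_smul]
    congr 1
    funext i
    by_contra hne
    apply hP i i₀ c (hcP i (Finset.mem_univ _))
    refine ⟨fun j => bas.repr ⟨w, hw⟩ j, L₀, q, (mem_homogeneousSubmodule _ _).1 hq, ?_, ?_⟩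
    · rw [← hwy]
      congr 1
      have := congrArg (fun z : W => (z : PolyR n)) (bas.sum_repr ⟨w, hw⟩)
      simp only [Submodule.coe_sum, Submodule.coe_smul, smul_eq_C_mul] at this
      exact this.symm
    · intro h
      apply hne
      simp only [Pi.smul_apply, smul_eq_mul]
      field_simp
      linear_combination -h
end
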